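/- Let f be an integral binary quartic form, irreducible over ℚ, with discriminant D, let κ be a real number with 0 < κ < 1, set D₁ = (7/2)¹² · 4⁴, and let r be a positive integer such that r¹²·|D| > D₁^{1/(1−κ)}. Then the number of pairs (x,y) ∈ ℤ² with |f(x,y)| = 1, counted up to the identification (x,y) ∼ (−x,−y), is at most ψ(r)·⌊36 + 8/κ⌋, where ψ(r) = r·∏_{p prime, p ∣ r}(1 + 1/p) is the Dedekind ψ-function. -/

import Mathlib

/-- Evaluation of the binary quartic form with coefficients `a, b, c, d, e` at `(x, y)`. -/
def quarticEval (a b c d e x y : ℤ) : ℤ :=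
  a * x ^ 4 + b * x ^ 3 * y + c * x ^ 2 * y ^ 2 + d * x * y ^ 3 + e * y ^ 4

/-- The discriminant of the integral binary quartic form `ax⁴ + bx³y + cx²y² + dxy³ + ey⁴`. -/
def quarticDisc (a b c d e : ℤ) : ℤ :=
  256 * a ^ 3 * e ^ 3 - 192 * a ^ 2 * b * d * e ^ 2 - 128 * a ^ 2 * c ^ 2 * e ^ 2
    + 144 * a ^ 2 * c * d ^ 2 * e - 27 * a ^ 2 * d ^ 4 + 144 * a * b ^ 2 * c * e ^ 2
    - 6 * a * b ^ 2 * d ^ 2 * e - 80 * a * b * c ^ 2 * d * e + 18 * a * b * c * d ^ 3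
    + 16 * a * c ^ 4 * e - 4 * a * c ^ 3 * d ^ 2 - 27 * b ^ 4 * e ^ 2
    + 18 * b ^ 3 * c * d * e - 4 * b ^ 3 * d ^ 3 - 4 * b ^ 2 * c ^ 3 * e
    + b ^ 2 * c ^ 2 * d ^ 2

open Polynomial in
/-- The dehomogenization `f(x,1)` (over `ℚ`) of the integral binary quartic form
`ax⁴ + bx³y + cx²y² + dxy³ + ey⁴`. -/
noncomputable def quarticPoly (a b c d e : ℤ) : Polynomial ℚ :=
  C (a : ℚ) * X ^ 4 + C (b : ℚ) * X ^ 3 + C (c : ℚ) * X ^ 2 + C (d : ℚ) * X + C (e : ℚ)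

/-- The Dedekind ψ-function `ψ(r) = r·∏_{p ∣ r} (1 + 1/p)`. -/
noncomputable def dedekindPsi (r : ℕ) : ℚ :=
  r * ∏ p ∈ r.primeFactors, (1 + 1/(p : ℚ))

open Polynomial

/-- The complex numbers `α 0, …, α 3` are the roots, with multiplicity, of the monic integral quartic
`X⁴ + bX³ + cX² + dX + e`. -/
structure QuarticRoots (b c d e : ℤ) (α : Fin 4 → ℂ) : Prop where
  sum_one : α 0 + α 1 + α 2 + α 3 = -b
  sum_two : α 0 * α 1 + α 0 * α 2 + α 0 * α 3 + α 1 * α 2 + α 1 * α 3 + α 2 * α 3 = c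
  sum_three : α 0 * α 1 * α 2 + α 0 * α 1 * α 3 + α 0 * α 2 * α 3 + α 1 * α 2 * α 3 = -d
  prod : α 0 * α 1 * α 2 * α 3 = e

namespace QuarticRoots

variable {b c d e : ℤ} {α : Fin 4 → ℂ}

theorem prod_sub (h : QuarticRoots b c d e α) (u v : ℂ) :
    ∏ i, (u - α i * v) = u ^ 4 + b * u ^ 3 * v + c * u ^ 2 * v ^ 2 + d * u * v ^ 3 + e * v ^ 4 := by
  rw [Fin.prod_univ_four]
  linear_combination (-u ^ 3 * v) * h.sum_one + u ^ 2 * v ^ 2 * h.sum_two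
    - u * v ^ 3 * h.sum_three + v ^ 4 * h.prod

theorem exists_powerSum (h : QuarticRoots b c d e α) (m : ℕ) :
    ∃ p : ℤ, (p : ℂ) = ∑ i, α i ^ m := by
  have root (i : Fin 4) : α i ^ 4 = -(b * α i ^ 3 + c * α i ^ 2 + d * α i + e) := by
    have h1 := h.prod_sub (α i) 1
    rw [Finset.prod_eq_zero (Finset.mem_univ i) (by ring)] at h1
    linear_combination -h1
  suffices H : ∀ m, (∃ p : ℤ, (p : ℂ) = ∑ i, α i ^ m) ∧ (∃ p : ℤ, (p : ℂ) = ∑ i, α i ^ (m + 1)) ∧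
      (∃ p : ℤ, (p : ℂ) = ∑ i, α i ^ (m + 2)) ∧ ∃ p : ℤ, (p : ℂ) = ∑ i, α i ^ (m + 3) from
    (H m).1
  intro m
  induction m with
  | zero =>
    simp only [Fin.sum_univ_four]
    refine ⟨⟨4, by norm_num⟩, ⟨-b, ?_⟩, ⟨b ^ 2 - 2 * c, ?_⟩, ⟨-b ^ 3 + 3 * b * c - 3 * d, ?_⟩⟩
    all_goals
      push_cast
      have h1 : (b : ℂ) = -(α 0 + α 1 + α 2 + α 3) := by rw [h.sum_one]; ring
      have h3 : (d : ℂ) = -(α 0 * α 1 * α 2 + α 0 * α 1 * α 3 + α 0 * α 2 * α 3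
        + α 1 * α 2 * α 3) := by rw [h.sum_three]; ring
      rw [h1]
      try rw [← h.sum_two]
      try rw [h3]
      ring
  | succ m ih =>
    obtain ⟨⟨p0, h0⟩, ⟨p1, h1⟩, ⟨p2, h2⟩, p3, h3⟩ := ih
    refine ⟨⟨p1, h1⟩, ⟨p2, h2⟩, ⟨p3, h3⟩, ⟨-(b * p3 + c * p2 + d * p1 + e * p0), ?_⟩⟩
    push_cast
    rw [h0, h1, h2, h3]
    simp only [Fin.sum_univ_four]
    linear_combination -α 0 ^ m * root 0 - α 1 ^ m * root 1 - α 2 ^ m * root 2 - α 3 ^ m * root 3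

/-- The monic quartic whose roots are the `α i`. -/
noncomputable def poly (b c d e : ℤ) : ℤ[X] := X ^ 4 + C b * X ^ 3 + C c * X ^ 2 + C d * X + C e

theorem map_poly (h : QuarticRoots b c d e α) :
    (poly b c d e).map (Int.castRingHom ℂ) = ∏ i, (X - C (α i)) := by
  have h1 := congrArg C h.sum_one
  have h2 := congrArg C h.sum_two
  have h3 := congrArg C h.sum_three
  have h4 := congrArg C h.prod
  simp only [map_add, map_mul, map_neg] at h1 h2 h3 h4
  simp only [poly, Polynomial.map_add, Polynomial.map_mul, Polynomial.map_pow, map_X,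
    Polynomial.map_C, Int.coe_castRingHom, Fin.prod_univ_four]
  linear_combination X ^ 3 * h1 - X ^ 2 * h2 + X * h3 - h4

theorem monic_poly : (poly b c d e).Monic := by
  unfold poly; monicity!

theorem natDegree_poly : (poly b c d e).natDegree = 4 := by
  unfold poly; compute_degree!

end QuarticRoots

/-- A complex linear form in powers of four distinct numbers vanishes if its moments do. -/
theorem eq_zero_of_sum_mul_pow_eq_zero {α : Fin 4 → ℂ} (hα : Function.Injective α) {z : Fin 4 → ℂ}
    (h : ∀ s : Fin 4, ∑ i, z i * α i ^ (s : ℕ) = 0) : z = 0 := by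
  have hdet : (Matrix.vandermonde α).det ≠ 0 := Matrix.det_vandermonde_ne_zero_iff.mpr hα
  refine Matrix.eq_zero_of_vecMul_eq_zero hdet ?_
  funext s
  simpa [Matrix.vecMul, dotProduct, Matrix.vandermonde_apply] using h s

section Siegel

open scoped Matrix.Norms.Elementwise

theorem coeff_sum_monomial {d : ℕ} (a : Fin (d + 1) → ℤ) (j : Fin (d + 1)) :
    (∑ i : Fin (d + 1), monomial (i : ℕ) (a i)).coeff j = a j := by
  simp [finsetSum_coeff, coeff_monomial, Fin.val_inj]

theorem coeff_sum_monomial_of_lt {d : ℕ} (a : Fin (d + 1) → ℤ) {j : ℕ} (hj : d < j) :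
    (∑ i : Fin (d + 1), monomial (i : ℕ) (a i)).coeff j = 0 := by
  simp only [finsetSum_coeff, coeff_monomial]
  exact Finset.sum_eq_zero fun i _ => if_neg (by omega)

theorem eval_hasseDeriv_sum_monomial {d : ℕ} (a : Fin (d + 1) → ℤ) (l : ℕ) (z : ℂ) :
    (hasseDeriv l ((∑ i : Fin (d + 1), monomial (i : ℕ) (a i)).map (Int.castRingHom ℂ))).eval z =
      ∑ i, (a i : ℂ) * ((i : ℕ).choose l * z ^ ((i : ℕ) - l)) := by
  simp only [Polynomial.map_sum, map_monomial, map_sum, hasseDeriv_monomial, eval_finsetSum,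
    eval_monomial, Int.coe_castRingHom]
  exact Finset.sum_congr rfl fun i _ => by ring

theorem X_sub_C_pow_dvd_of_hasseDeriv {K : Type*} [Field K] {p : K[X]} {z : K} {k : ℕ}
    (h : ∀ l < k, (hasseDeriv l p).eval z = 0) : (X - C z) ^ k ∣ p := by
  rw [X_sub_C_pow_dvd_iff, ← taylor_apply, X_pow_dvd_iff]
  intro l hl
  rw [taylor_coeff, h l hl]

namespace QuarticRoots

variable {b c d e : ℤ} {α : Fin 4 → ℂ}

/-- Siegel's lemma produces `A - Y B` vanishing to order `k` at every point `(α i, α i)`. -/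
theorem exists_auxiliary (h : QuarticRoots b c d e α) (hα : Function.Injective α) {M : ℝ}
    (hM : ∀ i, ‖α i‖ ≤ M) (hM1 : 1 ≤ M) {k n : ℕ} (hk : 0 < k) (hkn : 2 * k < n + 1) {H : ℝ}
    (hH : (8 * (n + 1) * 2 ^ n * M ^ (n + 4)) ^ ((2 * k : ℝ) / (n + 1 - 2 * k)) ≤ H) :
    ∃ A B : ℤ[X], A.natDegree ≤ n ∧ B.natDegree ≤ n ∧ (A ≠ 0 ∨ B ≠ 0) ∧
      (∀ j, |(A.coeff j : ℝ)| ≤ H) ∧ (∀ j, |(B.coeff j : ℝ)| ≤ H) ∧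
      ∀ i, (X - C (α i)) ^ k ∣
        A.map (Int.castRingHom ℂ) - C (α i) * B.map (Int.castRingHom ℂ) := by
  classical
  choose p hp using h.exists_powerSum
  have hpM (m : ℕ) (hm : m ≤ n + 4) : |(p m : ℝ)| ≤ 4 * M ^ (n + 4) := by
    have h1 : |(p m : ℝ)| = ‖(p m : ℂ)‖ := by rw [Complex.norm_intCast]
    rw [h1, hp]
    calc ‖∑ i, α i ^ m‖ ≤ ∑ i : Fin 4, M ^ (n + 4) := by
          refine norm_sum_le_of_le _ fun i _ => ?_
          rw [norm_pow]
          exact (pow_le_pow_left₀ (norm_nonneg _) (hM i) m).trans (pow_le_pow_right₀ hM1 hm)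
      _ = 4 * M ^ (n + 4) := by simp
  let T : Matrix (Fin k × Fin 4) (Fin (n + 1) ⊕ Fin (n + 1)) ℤ := fun r =>
    Sum.elim (fun j => (j : ℕ).choose r.1 * p (j - r.1 + r.2))
      (fun j => -((j : ℕ).choose r.1 * p (j - r.1 + 1 + r.2)))
  have entry (j : Fin (n + 1)) (l m : ℕ) (hm : m ≤ n + 4) :
      |((((j : ℕ).choose l * p m : ℤ)) : ℝ)| ≤ 4 * 2 ^ n * M ^ (n + 4) := by
    push_cast
    rw [abs_mul, abs_of_nonneg (Nat.cast_nonneg _)]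
    have h1 : (((j : ℕ).choose l : ℕ) : ℝ) ≤ 2 ^ n := by
      have : (j : ℕ).choose l ≤ 2 ^ n :=
        (Nat.choose_le_two_pow _ _).trans (Nat.pow_le_pow_right (by norm_num) (by omega))
      exact_mod_cast this
    calc _ ≤ (2 : ℝ) ^ n * (4 * M ^ (n + 4)) :=
          mul_le_mul h1 (hpM m hm) (abs_nonneg _) (by positivity)
      _ = _ := by ring
  have hMp : (1 : ℝ) ≤ M ^ (n + 4) := one_le_pow₀ hM1
  have hT : ‖T‖ ≤ 4 * 2 ^ n * M ^ (n + 4) := by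
    rw [Matrix.norm_le_iff (by positivity)]
    rintro ⟨l, s⟩ (j | j)
    · exact entry j l _ (by omega)
    · simp only [T, Sum.elim_inr, norm_neg]
      exact entry j l _ (by omega)
  obtain ⟨t, ht0, ht, htn⟩ := Int.Matrix.exists_ne_zero_int_vec_norm_le T
    (by simp; omega) (by simp; omega)
  have hden : (0 : ℝ) < n + 1 - 2 * k := by
    have : ((2 * k : ℕ) : ℝ) < ((n + 1 : ℕ) : ℝ) := by exact_mod_cast hkn
    push_cast at this; linarith
  have htH : ‖t‖ ≤ H := by
    refine htn.trans (le_trans ?_ hH)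
    have h2 : ((Fintype.card (Fin k × Fin 4) : ℕ) : ℝ) /
        ((Fintype.card (Fin (n + 1) ⊕ Fin (n + 1)) : ℕ) -
          (Fintype.card (Fin k × Fin 4) : ℕ)) = (2 * k : ℝ) / (n + 1 - 2 * k) := by
      simp only [Fintype.card_prod, Fintype.card_fin, Fintype.card_sum]
      push_cast
      rw [div_eq_div_iff (by linarith) hden.ne']
      ring
    rw [h2]
    refine Real.rpow_le_rpow (by positivity) ?_ (by positivity)
    have h3 : max 1 ‖T‖ ≤ 4 * 2 ^ n * M ^ (n + 4) := by
      refine max_le ?_ hT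
      have : (1 : ℝ) ≤ 2 ^ n := one_le_pow₀ (by norm_num)
      nlinarith
    calc _ ≤ ((Fintype.card (Fin (n + 1) ⊕ Fin (n + 1)) : ℕ) : ℝ) *
          (4 * 2 ^ n * M ^ (n + 4)) := by gcongr
      _ = _ := by
        simp only [Fintype.card_fin, Fintype.card_sum]
        push_cast
        ring
  have hcoef (x : Fin (n + 1) ⊕ Fin (n + 1)) : |(t x : ℝ)| ≤ H := by
    have := (norm_le_pi_norm t x).trans htH
    rwa [Int.norm_eq_abs] at this
  have hH0 : 0 ≤ H := (norm_nonneg _).trans htH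
  refine ⟨∑ j : Fin (n + 1), monomial (j : ℕ) (t (Sum.inl j)), ∑ j : Fin (n + 1), monomial (j : ℕ) (t (Sum.inr j)),
    ?_, ?_, ?_, ?_, ?_, ?_⟩
  · exact natDegree_le_iff_coeff_eq_zero.mpr fun j hj => coeff_sum_monomial_of_lt _ hj
  · exact natDegree_le_iff_coeff_eq_zero.mpr fun j hj => coeff_sum_monomial_of_lt _ hj
  · by_contra hcon
    push Not at hcon
    refine ht0 (funext ?_)
    rintro (j | j)
    · rw [← coeff_sum_monomial (fun j => t (Sum.inl j)) j, hcon.1]; simp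
    · rw [← coeff_sum_monomial (fun j => t (Sum.inr j)) j, hcon.2]; simp
  · intro j
    rcases le_or_gt j n with hj | hj
    · rw [coeff_sum_monomial (fun j => t (Sum.inl j)) ⟨j, by omega⟩]; exact hcoef _
    · rw [coeff_sum_monomial_of_lt _ hj]; simpa
  · intro j
    rcases le_or_gt j n with hj | hj
    · rw [coeff_sum_monomial (fun j => t (Sum.inr j)) ⟨j, by omega⟩]; exact hcoef _
    · rw [coeff_sum_monomial_of_lt _ hj]; simpa
  · intro i
    refine X_sub_C_pow_dvd_of_hasseDeriv fun l hl => ?_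
    let z : Fin 4 → ℂ := fun i =>
      (∑ j : Fin (n + 1), (t (Sum.inl j) : ℂ) * ((j : ℕ).choose l * α i ^ ((j : ℕ) - l))) -
      α i * ∑ j : Fin (n + 1), (t (Sum.inr j) : ℂ) * ((j : ℕ).choose l * α i ^ ((j : ℕ) - l))
    have hz : z = 0 := by
      refine eq_zero_of_sum_mul_pow_eq_zero hα fun s => ?_
      have h5 := congrFun ht (⟨l, hl⟩, s)
      simp only [Matrix.mulVec, dotProduct, Fintype.sum_sum_type, T, Sum.elim_inl, Sum.elim_inr,
        Pi.zero_apply] at h5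
      have h6 := congrArg (Int.cast : ℤ → ℂ) h5
      push_cast at h6
      simp only [hp] at h6
      rw [← h6]
      simp only [z, sub_mul, Finset.sum_sub_distrib, Finset.mul_sum, Finset.sum_mul, neg_mul,
        Finset.sum_neg_distrib, ← sub_eq_add_neg]
      congr 1
      · rw [Finset.sum_comm]
        refine Finset.sum_congr rfl fun j _ => Finset.sum_congr rfl fun i _ => ?_
        rw [pow_add]; ring
      · rw [Finset.sum_comm]
        refine Finset.sum_congr rfl fun j _ => Finset.sum_congr rfl fun i _ => ?_
        rw [pow_add, pow_succ]; ring
    have := congrFun hz i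
    rw [map_sub, eval_sub, ← smul_eq_C_mul, (hasseDeriv l).map_smul, eval_smul,
      eval_hasseDeriv_sum_monomial, eval_hasseDeriv_sum_monomial]
    exact this

end QuarticRoots

end Siegel

section Wronskian

variable {K : Type*} [Field K]

theorem X_sub_C_pow_dvd_wronskian {a b : K[X]} {z c : K} {v : ℕ}
    (h : (X - C z) ^ (v + 1) ∣ a - C c * b) : (X - C z) ^ v ∣ wronskian a b := by
  have h1 : wronskian a b = (a - C c * b) * derivative b - derivative (a - C c * b) * b := by
    simp only [wronskian, derivative_sub, derivative_C_mul]; ring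
  rw [h1]
  refine dvd_sub (Dvd.dvd.mul_right ((pow_dvd_pow _ v.le_succ).trans h) _) (Dvd.dvd.mul_right ?_ _)
  simpa using pow_sub_one_dvd_derivative_of_pow_dvd h

variable [CharZero K]

theorem natDegree_eq_of_wronskian_eq_zero {a b : K[X]} (ha : a ≠ 0) (hb : b ≠ 0)
    (h : wronskian a b = 0) : a.natDegree = b.natDegree := by
  have const {a b : K[X]} (ha : a ≠ 0) (hb : b ≠ 0) (h : a * derivative b = derivative a * b)
      (hn : a.natDegree = 0) : b.natDegree = 0 := by
    rw [derivative_of_natDegree_zero hn, zero_mul] at h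
    exact derivative_eq_zero.mp ((mul_eq_zero.mp h).resolve_left ha)
  have h : a * derivative b = derivative a * b := sub_eq_zero.mp h
  rcases Nat.eq_zero_or_pos a.natDegree with hn | hn
  · rw [hn, const ha hb h hn]
  rcases Nat.eq_zero_or_pos b.natDegree with hm | hm
  · rw [hm, const hb ha (by rw [mul_comm, ← h, mul_comm]) hm]
  obtain ⟨n, hn⟩ := Nat.exists_eq_succ_of_ne_zero hn.ne'
  obtain ⟨m, hm⟩ := Nat.exists_eq_succ_of_ne_zero hm.ne'
  have h1 := congrArg (fun p => p.coeff (n + 1 + m)) h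
  beta_reduce at h1
  rw [coeff_mul_add_eq_of_natDegree_le hn.le ((natDegree_derivative_le b).trans (by omega)),
    show n + 1 + m = n + (m + 1) by ring,
    coeff_mul_add_eq_of_natDegree_le ((natDegree_derivative_le a).trans (by omega)) hm.le,
    coeff_derivative, coeff_derivative] at h1
  have hla : a.coeff (n + 1) ≠ 0 := by
    have := leadingCoeff_ne_zero.mpr ha
    rwa [leadingCoeff, hn] at this
  have hlb : b.coeff (m + 1) ≠ 0 := by
    have := leadingCoeff_ne_zero.mpr hb
    rwa [leadingCoeff, hm] at this
  have h2 : ((m : K) + 1) = n + 1 := by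
    apply mul_left_cancel₀ (mul_ne_zero hla hlb)
    linear_combination h1
  rw [hn, hm]
  exact_mod_cast h2.symm

theorem exists_eq_C_mul_of_wronskian_eq_zero {a b : K[X]} (hb : b ≠ 0) (h : wronskian a b = 0) :
    ∃ c, a = C c * b := by
  by_cases ha : a = 0
  · exact ⟨0, by simp [ha]⟩
  have hdeg := natDegree_eq_of_wronskian_eq_zero ha hb h
  refine ⟨a.leadingCoeff / b.leadingCoeff, ?_⟩
  by_contra hne
  set c := a.leadingCoeff / b.leadingCoeff with hc
  have hlb := leadingCoeff_ne_zero.mpr hb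
  have hc0 : c ≠ 0 := div_ne_zero (leadingCoeff_ne_zero.mpr ha) hlb
  have h1 : wronskian (a - C c * b) b = 0 := by
    rw [← h]
    simp only [wronskian, derivative_sub, derivative_C_mul]; ring
  have h2 := natDegree_eq_of_wronskian_eq_zero (sub_ne_zero.mpr hne) hb h1
  have hd : a.degree = (C c * b).degree := by
    rw [degree_C_mul hc0, degree_eq_natDegree ha, degree_eq_natDegree hb, hdeg]
  have h3 : (a - C c * b).degree < a.degree :=
    degree_sub_lt_left hd ha (by rw [leadingCoeff_mul, leadingCoeff_C, hc, div_mul_cancel₀ _ hlb])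
  rw [degree_eq_natDegree (sub_ne_zero.mpr hne), degree_eq_natDegree ha, h2, hdeg] at h3
  exact lt_irrefl _ h3

end Wronskian

theorem abs_coeff_wronskian_le {A B : ℤ[X]} {n : ℕ} (hA : A.natDegree ≤ n) (hB : B.natDegree ≤ n)
    {H : ℝ} (hAH : ∀ j, |(A.coeff j : ℝ)| ≤ H) (hBH : ∀ j, |(B.coeff j : ℝ)| ≤ H)
    {m : ℕ} (hm : m ≤ 2 * n) :
    |((wronskian A B).coeff m : ℝ)| ≤ 4 * (n + 1) ^ 2 * H ^ 2 := by
  have hH : 0 ≤ H := (abs_nonneg _).trans (hAH 0)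
  have key {P Q : ℤ[X]} (hQ : Q.natDegree ≤ n) (hP : ∀ j, |(P.coeff j : ℝ)| ≤ H)
      (hQH : ∀ j, |(Q.coeff j : ℝ)| ≤ H) :
      |((P * derivative Q).coeff m : ℝ)| ≤ 2 * (n + 1) ^ 2 * H ^ 2 := by
    have hder (j : ℕ) : |((derivative Q).coeff j : ℝ)| ≤ n * H := by
      rw [coeff_derivative]
      push_cast
      rcases lt_or_ge n (j + 1) with hj | hj
      · rw [coeff_eq_zero_of_natDegree_lt (by omega)]
        simp only [Int.cast_zero, zero_mul, abs_zero]; positivity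
      · rw [abs_mul, mul_comm]
        have h1 : |(j : ℝ) + 1| ≤ n := by
          rw [abs_of_nonneg (by positivity)]; exact_mod_cast hj
        exact mul_le_mul h1 (hQH _) (abs_nonneg _) (by positivity)
    rw [coeff_mul]
    push_cast
    calc _ ≤ ∑ x ∈ Finset.HasAntidiagonal.antidiagonal m, H * (n * H) := by
          refine (Finset.abs_sum_le_sum_abs _ _).trans (Finset.sum_le_sum fun x _ => ?_)
          rw [abs_mul]
          exact mul_le_mul (hP _) (hder _) (abs_nonneg _) hH
      _ = (m + 1) * (H * (n * H)) := by
          simp [Finset.Nat.card_antidiagonal]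
      _ ≤ (2 * n + 1) * (H * (n * H)) := by
          have : (m : ℝ) ≤ 2 * n := by exact_mod_cast hm
          gcongr
      _ ≤ _ := by
          have : (0 : ℝ) ≤ H ^ 2 := by positivity
          have : (0 : ℝ) ≤ n := by positivity
          nlinarith
  have h1 : wronskian A B = A * derivative B - B * derivative A := by
    rw [wronskian]; ring
  rw [h1, coeff_sub]
  push_cast
  have := abs_sub ((A * derivative B).coeff m : ℝ) ((B * derivative A).coeff m : ℝ)
  linarith [key hB hAH hBH, key hA hBH hAH]

theorem isPrimitive_C_mul_X_sub_C {x y : ℤ} (h : IsCoprime x y) :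
    (C y * X - C x : ℤ[X]).IsPrimitive := by
  intro r hr
  rw [C_dvd_iff_dvd_coeff] at hr
  have h0 := hr 0
  have h1 := hr 1
  rw [coeff_sub, coeff_C_mul, coeff_X_zero, coeff_C_zero, mul_zero, zero_sub, dvd_neg] at h0
  rw [coeff_sub, coeff_C_mul, coeff_X_one, coeff_C_succ, mul_one, sub_zero] at h1
  exact h.isUnit_of_dvd' h0 h1

/-- An integral polynomial with a zero of order `v` at `x / y` has leading coefficient divisible
by `y ^ v`. -/
theorem pow_dvd_leadingCoeff_of_X_sub_C_pow_dvd {R : ℤ[X]} {x y : ℤ}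
    (hxy : IsCoprime x y) (hy : y ≠ 0) {v : ℕ}
    (h : (X - C ((x : ℚ) / y)) ^ v ∣ R.map (Int.castRingHom ℚ)) : y ^ v ∣ R.leadingCoeff := by
  have hyQ : (y : ℚ) ≠ 0 := by exact_mod_cast hy
  have hl : (C y * X - C x : ℤ[X]).map (Int.castRingHom ℚ) = C (y : ℚ) * (X - C ((x : ℚ) / y)) := by
    simp only [Polynomial.map_sub, Polynomial.map_mul, Polynomial.map_C, map_X,
      Int.coe_castRingHom, mul_sub, ← C_mul, mul_div_cancel₀ _ hyQ]
  have hprim : ((C y * X - C x : ℤ[X]) ^ v).IsPrimitive := by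
    induction v with
    | zero => simp
    | succ v ih => rw [pow_succ]; exact (ih ((pow_dvd_pow _ v.le_succ).trans h)).mul (isPrimitive_C_mul_X_sub_C hxy)
  have hdvd : (C y * X - C x : ℤ[X]) ^ v ∣ R := by
    refine (IsPrimitive.Int.dvd_iff_map_cast_dvd_map_cast _ _ hprim).mpr ?_
    rw [Polynomial.map_pow, hl, mul_pow, ← C_pow]
    have hu : IsUnit (C ((y : ℚ) ^ v)) := isUnit_C.mpr (pow_ne_zero v hyQ).isUnit
    rwa [hu.mul_left_dvd]
  have h3 := leadingCoeff_dvd_leadingCoeff hdvd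
  rw [leadingCoeff_pow] at h3
  have h4 : (C y * X - C x : ℤ[X]).leadingCoeff = y := by
    have : (C y * X - C x : ℤ[X]) = C y * X + C (-x) := by simp [sub_eq_add_neg]
    rw [this, leadingCoeff_linear hy]
  rwa [h4] at h3

theorem wronskian_map {R S : Type*} [CommRing R] [CommRing S] (f : R →+* S) (a b : R[X]) :
    wronskian (a.map f) (b.map f) = (wronskian a b).map f := by
  simp only [wronskian, Polynomial.map_sub, Polynomial.map_mul, derivative_map]

theorem int_map_rat_map (P : ℤ[X]) :
    (P.map (Int.castRingHom ℚ)).map (algebraMap ℚ ℂ) = P.map (Int.castRingHom ℂ) := by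
  rw [Polynomial.map_map]; congr 1

namespace QuarticRoots

variable {b c d e : ℤ} {α : Fin 4 → ℂ}

theorem poly_pow_dvd (h : QuarticRoots b c d e α) (hα : Function.Injective α) {P : ℤ[X]} {m : ℕ}
    (hP : ∀ i, (X - C (α i)) ^ m ∣ P.map (Int.castRingHom ℂ)) : poly b c d e ^ m ∣ P := by
  refine (Polynomial.map_dvd_map (Int.castRingHom ℂ) Int.cast_injective
    (monic_poly.pow m)).mp ?_
  rw [Polynomial.map_pow, h.map_poly, ← Finset.prod_pow]
  exact Finset.prod_dvd_of_coprime
    (fun i _ j _ hij => (pairwise_coprime_X_sub_C hα hij).pow) fun i _ => hP i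

theorem eq_zero_of_X_sub_C_pow_dvd (h : QuarticRoots b c d e α) (hα : Function.Injective α)
    {P : ℤ[X]} {m : ℕ} (hP : ∀ i, (X - C (α i)) ^ m ∣ P.map (Int.castRingHom ℂ))
    (hdeg : P.natDegree < 4 * m) : P = 0 := by
  by_contra hne
  have := natDegree_le_of_dvd (h.poly_pow_dvd hα hP) hne
  rw [monic_poly.natDegree_pow, natDegree_poly] at this
  omega

theorem wronskian_ne_zero (h : QuarticRoots b c d e α) (hα : Function.Injective α)
    (hrat : ∀ i (q : ℚ), α i ≠ q) {A B : ℤ[X]} {k n : ℕ} (hA : A.natDegree ≤ n)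
    (hB : B.natDegree ≤ n) (hnk : n < 4 * k) (hAB : A ≠ 0 ∨ B ≠ 0)
    (hdvd : ∀ i, (X - C (α i)) ^ k ∣
      A.map (Int.castRingHom ℂ) - C (α i) * B.map (Int.castRingHom ℂ)) :
    wronskian A B ≠ 0 := by
  intro hW
  by_cases hB0 : B = 0
  · refine hAB.resolve_right (not_not.mpr hB0)
      (h.eq_zero_of_X_sub_C_pow_dvd hα (m := k) (fun i => ?_) (hA.trans_lt hnk))
    simpa [hB0] using hdvd i
  · have hBQ : B.map (Int.castRingHom ℚ) ≠ 0 :=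
      (Polynomial.map_ne_zero_iff Int.cast_injective).mpr hB0
    obtain ⟨q, hq⟩ := exists_eq_C_mul_of_wronskian_eq_zero (a := A.map (Int.castRingHom ℚ)) hBQ
      (by rw [wronskian_map, hW, Polynomial.map_zero])
    refine hB0 (h.eq_zero_of_X_sub_C_pow_dvd hα (m := k) (fun i => ?_) (hB.trans_lt hnk))
    have h1 := congrArg (Polynomial.map (algebraMap ℚ ℂ)) hq
    rw [Polynomial.map_mul, int_map_rat_map, int_map_rat_map, Polynomial.map_C] at h1
    have h2 := hdvd i
    rw [h1, ← sub_mul, ← C_sub] at h2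
    have hu : IsUnit (C ((algebraMap ℚ ℂ) q - α i)) :=
      isUnit_C.mpr (sub_ne_zero.mpr (hrat i q).symm).isUnit
    rwa [hu.dvd_mul_left] at h2

/-- The auxiliary polynomials vanish to low order only at points outside the diagonal. -/
theorem exists_hasseDeriv_ne (h : QuarticRoots b c d e α) (hα : Function.Injective α)
    (hrat : ∀ i (q : ℚ), α i ≠ q) {A B : ℤ[X]} {k n : ℕ} (hk : 0 < k) (hA : A.natDegree ≤ n)
    (hB : B.natDegree ≤ n) (hnk : n < 4 * k) (hAB : A ≠ 0 ∨ B ≠ 0)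
    (hdvd : ∀ i, (X - C (α i)) ^ k ∣
      A.map (Int.castRingHom ℂ) - C (α i) * B.map (Int.castRingHom ℂ))
    {H : ℝ} (hAH : ∀ j, |(A.coeff j : ℝ)| ≤ H) (hBH : ∀ j, |(B.coeff j : ℝ)| ≤ H)
    {x y : ℤ} (hxy : IsCoprime x y) (hy : 0 < y) {v : ℕ}
    (hv : 4 * (n + 1) ^ 2 * H ^ 2 < (y : ℝ) ^ v) (ξ : ℚ) :
    ∃ j ≤ v, (hasseDeriv j (A.map (Int.castRingHom ℚ))).eval ((x : ℚ) / y) ≠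
      ξ * (hasseDeriv j (B.map (Int.castRingHom ℚ))).eval ((x : ℚ) / y) := by
  by_contra! hcon
  have hW := h.wronskian_ne_zero hα hrat hA hB hnk hAB hdvd
  have h1 : (X - C ((x : ℚ) / y)) ^ v ∣ (wronskian A B).map (Int.castRingHom ℚ) := by
    rw [← wronskian_map]
    refine X_sub_C_pow_dvd_wronskian (c := ξ) (X_sub_C_pow_dvd_of_hasseDeriv fun l hl => ?_)
    rw [map_sub, eval_sub, ← smul_eq_C_mul, (hasseDeriv l).map_smul, eval_smul,
      hcon l (by omega), smul_eq_mul, sub_self]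
  have h2 : poly b c d e ^ (k - 1) ∣ wronskian A B := by
    refine h.poly_pow_dvd hα fun i => ?_
    rw [← wronskian_map]
    refine X_sub_C_pow_dvd_wronskian (c := α i) ?_
    rw [Nat.sub_add_cancel hk]
    exact hdvd i
  obtain ⟨R, hR⟩ := h2
  have h3 : (X - C ((x : ℚ) / y)) ^ v ∣ R.map (Int.castRingHom ℚ) := by
    rw [hR, Polynomial.map_mul, Polynomial.map_pow] at h1
    refine IsCoprime.dvd_of_dvd_mul_left (IsCoprime.pow ?_) h1
    refine (irreducible_X_sub_C _).coprime_iff_not_dvd.mpr fun hd => ?_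
    have h4 := Polynomial.map_dvd (algebraMap ℚ ℂ) hd
    rw [int_map_rat_map, h.map_poly, Polynomial.map_sub, map_X, Polynomial.map_C,
      dvd_iff_isRoot, IsRoot, eval_prod] at h4
    obtain ⟨i, -, hi⟩ := Finset.prod_eq_zero_iff.mp h4
    refine hrat i ((x : ℚ) / y) ?_
    simp only [eval_sub, eval_X, eval_C] at hi
    exact (sub_eq_zero.mp hi).symm
  have h5 := pow_dvd_leadingCoeff_of_X_sub_C_pow_dvd hxy hy.ne' h3
  have h6 : (wronskian A B).leadingCoeff = R.leadingCoeff := by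
    rw [hR, leadingCoeff_mul, (monic_poly.pow _).leadingCoeff, one_mul]
  rw [← h6] at h5
  have h7 := Int.le_of_dvd (abs_pos.mpr (leadingCoeff_ne_zero.mpr hW)) ((dvd_abs _ _).mpr h5)
  have h8 : (wronskian A B).natDegree ≤ 2 * n := by
    have := natDegree_wronskian_lt_add hW
    omega
  have h9 := abs_coeff_wronskian_le hA hB hAH hBH h8
  have h10 : (y : ℝ) ^ v ≤ |((wronskian A B).leadingCoeff : ℝ)| := by exact_mod_cast h7
  exact absurd (h10.trans h9) (not_le.mpr hv)

end QuarticRoots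

theorem map_hasseDeriv_eq {R S : Type*} [Semiring R] [Semiring S] (f : R →+* S) (l : ℕ) (P : R[X]) :
    (hasseDeriv l P).map f = hasseDeriv l (P.map f) := by
  ext m
  simp [hasseDeriv_coeff]

theorem eval_hasseDeriv_eq_sum {R : Type*} [CommSemiring R] {P : R[X]} {n : ℕ}
    (hP : P.natDegree ≤ n) (l : ℕ) (z : R) :
    (hasseDeriv l P).eval z =
      ∑ i ∈ Finset.range (n + 1), P.coeff i * ((i.choose l : R) * z ^ (i - l)) := by
  conv_lhs => rw [P.as_sum_range' (n + 1) (by omega)]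
  simp only [map_sum, hasseDeriv_monomial, eval_finsetSum, eval_monomial]
  exact Finset.sum_congr rfl fun i _ => by ring

theorem eval_hasseDeriv_eq_sum_hasseDeriv {R : Type*} [CommRing R] {P : R[X]} {n : ℕ}
    (hP : P.natDegree ≤ n) (l : ℕ) (w z : R) :
    (hasseDeriv l P).eval z = ∑ i ∈ Finset.range (n + 1),
      (hasseDeriv i P).eval w * ((i.choose l : R) * (z - w) ^ (i - l)) := by
  have h1 : (hasseDeriv l P).eval z = (hasseDeriv l (taylor w P)).eval (z - w) := by
    rw [← taylor_coeff, ← taylor_coeff, taylor_taylor, sub_add_cancel]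
  rw [h1, eval_hasseDeriv_eq_sum ((natDegree_taylor P w).le.trans hP)]
  simp only [taylor_coeff]

section Bounds

variable {P : ℂ[X]} {n : ℕ} {H M : ℝ}

theorem choose_mul_pow_le_add_one_pow {ρ : ℝ} (hρ : 0 ≤ ρ) (i l : ℕ) :
    (i.choose l : ℝ) * ρ ^ (i - l) ≤ (ρ + 1) ^ i := by
  rcases lt_or_ge i l with h | h
  · rw [Nat.choose_eq_zero_of_lt h]; simp; positivity
  · rw [add_comm, add_pow]
    refine le_trans (le_of_eq ?_) (Finset.single_le_sum
      (f := fun m => (1 : ℝ) ^ m * ρ ^ (i - m) * (i.choose m)) (fun m _ => by positivity)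
      (Finset.mem_range.mpr (Nat.lt_succ_of_le h)))
    simp only [one_pow, one_mul]; ring

theorem norm_eval_hasseDeriv_le (hP : P.natDegree ≤ n) (hc : ∀ j, ‖P.coeff j‖ ≤ H) (hM : 1 ≤ M)
    {z : ℂ} (hz : ‖z‖ ≤ 2 * M) (l : ℕ) :
    ‖(hasseDeriv l P).eval z‖ ≤ (n + 1) * 3 ^ n * M ^ n * H := by
  have hH : 0 ≤ H := (norm_nonneg _).trans (hc 0)
  rw [eval_hasseDeriv_eq_sum hP]
  calc _ ≤ ∑ i ∈ Finset.range (n + 1), H * (3 * M) ^ n := by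
        refine norm_sum_le_of_le _ fun i hi => ?_
        rw [norm_mul, norm_mul, norm_pow, Complex.norm_natCast]
        refine mul_le_mul (hc i) ?_ (by positivity) hH
        refine (choose_mul_pow_le_add_one_pow (norm_nonneg _) i l).trans ?_
        refine (pow_le_pow_left₀ (by positivity) (by linarith) i).trans
          (pow_le_pow_right₀ (by linarith) (by simpa [Nat.lt_succ_iff] using hi))
    _ = _ := by simp [mul_pow]; ring

theorem norm_eval_hasseDeriv_le_of_X_sub_C_pow_dvd (hP : P.natDegree ≤ n)
    (hc : ∀ j, ‖P.coeff j‖ ≤ H) (hM : 1 ≤ M) {w z : ℂ} (hw : ‖w‖ ≤ M) (hzw : ‖z - w‖ ≤ 1) {k l : ℕ}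
    (hlk : l ≤ k) (hd : (X - C w) ^ k ∣ P) :
    ‖(hasseDeriv l P).eval z‖ ≤ (n + 1) * 3 ^ n * M ^ n * H * ‖z - w‖ ^ (k - l) := by
  have hH : 0 ≤ H := (norm_nonneg _).trans (hc 0)
  have hM0 : 0 < M := by linarith
  have hzero : ∀ i < k, (hasseDeriv i P).eval w = 0 := by
    intro i hi
    rw [X_sub_C_pow_dvd_iff, ← taylor_apply, X_pow_dvd_iff] at hd
    rw [← taylor_coeff, hd i hi]
  have hder (i : ℕ) : ‖(hasseDeriv i P).eval w‖ ≤
      ∑ m ∈ Finset.range (n + 1), H * ((m.choose i : ℝ) * M ^ n) := by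
    rw [eval_hasseDeriv_eq_sum hP]
    refine norm_sum_le_of_le _ fun m hm => ?_
    rw [norm_mul, norm_mul, norm_pow, Complex.norm_natCast]
    have hm : m ≤ n := by simpa [Nat.lt_succ_iff] using hm
    refine mul_le_mul (hc m) (mul_le_mul_of_nonneg_left ?_ (by positivity)) (by positivity) hH
    exact (pow_le_pow_left₀ (norm_nonneg _) hw _).trans (pow_le_pow_right₀ hM (by omega))
  rw [eval_hasseDeriv_eq_sum_hasseDeriv hP l w]
  calc _ ≤ ∑ i ∈ Finset.range (n + 1), (∑ m ∈ Finset.range (n + 1),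
          H * ((m.choose i : ℝ) * M ^ n)) * (2 ^ i * ‖z - w‖ ^ (k - l)) := by
        refine norm_sum_le_of_le _ fun i _ => ?_
        rcases lt_or_ge i k with hi | hi
        · rw [hzero i hi]; simp only [zero_mul, norm_zero]; positivity
        rw [norm_mul, norm_mul, norm_pow, Complex.norm_natCast]
        refine mul_le_mul (hder i) ?_ (by positivity) (by positivity)
        refine mul_le_mul (by exact_mod_cast Nat.choose_le_two_pow i l)
          (pow_le_pow_of_le_one (norm_nonneg _) hzw (by omega)) (by positivity) (by positivity)
    _ = ∑ m ∈ Finset.range (n + 1), H * M ^ n * ‖z - w‖ ^ (k - l) *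
          ∑ i ∈ Finset.range (n + 1), 2 ^ i * (m.choose i : ℝ) := by
        simp only [Finset.sum_mul, Finset.mul_sum]
        rw [Finset.sum_comm]
        exact Finset.sum_congr rfl fun m _ => Finset.sum_congr rfl fun i _ => by ring
    _ ≤ ∑ m ∈ Finset.range (n + 1), H * M ^ n * ‖z - w‖ ^ (k - l) * 3 ^ n := by
        refine Finset.sum_le_sum fun m hm => ?_
        have hm : m ≤ n := by simpa [Nat.lt_succ_iff] using hm
        have h1 : ∑ i ∈ Finset.range (n + 1), 2 ^ i * (m.choose i : ℝ) = (2 + 1) ^ m := by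
          rw [add_pow]
          simp only [one_pow, mul_one]
          refine (Finset.sum_subset (Finset.range_mono (by omega)) fun i _ hi => ?_).symm
          rw [Nat.choose_eq_zero_of_lt (by simpa using hi)]; simp
        rw [h1]
        refine mul_le_mul_of_nonneg_left ?_ (by positivity)
        norm_num
        exact pow_le_pow_right₀ (by norm_num) hm
    _ = _ := by simp; ring

end Bounds

namespace QuarticRoots

variable {b c d e : ℤ} {α : Fin 4 → ℂ}

/-- Thue's inequality for two rational approximations of the same root. -/
theorem exists_one_le_pow_mul (h : QuarticRoots b c d e α) (hα : Function.Injective α)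
    (hrat : ∀ i (q : ℚ), α i ≠ q) {M : ℝ} (hM : ∀ i, ‖α i‖ ≤ M) (hM1 : 1 ≤ M) {k n v : ℕ}
    (hkn : 2 * k < n + 1) (hnk : n < 4 * k) (hvk : v < k) {H : ℝ}
    (hH : (8 * (n + 1) * 2 ^ n * M ^ (n + 4)) ^ ((2 * k : ℝ) / (n + 1 - 2 * k)) ≤ H)
    {x₁ y₁ x₂ y₂ : ℤ} (hxy : IsCoprime x₁ y₁) (hy₁ : 0 < y₁) (hy₂ : 0 < y₂)
    (hv : 4 * (n + 1) ^ 2 * H ^ 2 < (y₁ : ℝ) ^ v) (i : Fin 4)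
    (hi : ‖(x₁ / y₁ : ℂ) - α i‖ ≤ 1) :
    ∃ j ≤ v, 1 ≤ (y₁ : ℝ) ^ (n - j) * (2 * (n + 1) * 3 ^ n * M ^ (n + 1) * H) *
      (y₂ * ‖(x₁ / y₁ : ℂ) - α i‖ ^ (k - j) + ‖α i * y₂ - x₂‖) := by
  obtain ⟨A, B, hA, hB, hAB, hAH, hBH, hdvd⟩ :=
    h.exists_auxiliary hα hM hM1 (by omega : 0 < k) hkn hH
  have hH0 : 0 ≤ H := (abs_nonneg _).trans (hAH 0)
  obtain ⟨j, hj, hne⟩ := h.exists_hasseDeriv_ne hα hrat (by omega : 0 < k) hA hB hnk hAB hdvd hAH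
    hBH hxy hy₁ hv ((x₂ : ℚ) / y₂)
  refine ⟨j, hj, ?_⟩
  have hy₂Q : (y₂ : ℚ) ≠ 0 := by exact_mod_cast hy₂.ne'
  set g : ℤ[X] := C y₂ * hasseDeriv j A - C x₂ * hasseDeriv j B with hg
  have hgdeg : g.natDegree ≤ n - j := by
    refine (natDegree_sub_le _ _).trans (max_le ?_ ?_) <;>
    refine (natDegree_C_mul_le _ _).trans ((natDegree_hasseDeriv_le _ _).trans (by omega))
  have hmap (K : Type) [Field K] (z : K) : (g.map (Int.castRingHom K)).eval z =
      y₂ * (hasseDeriv j (A.map (Int.castRingHom K))).eval z -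
        x₂ * (hasseDeriv j (B.map (Int.castRingHom K))).eval z := by
    simp [hg, map_hasseDeriv_eq]
  have h1 : (g.map (algebraMap ℤ ℚ)).eval ((x₁ : ℚ) / y₁) ≠ 0 := by
    have := hmap ℚ ((x₁ : ℚ) / y₁)
    rw [algebraMap_int_eq, this]
    intro h0
    refine hne ?_
    field_simp
    linear_combination h0
  have h2 := one_le_pow_mul_abs_eval_div hy₁ h1
  have h3 : (1 : ℝ) ≤ (y₁ : ℝ) ^ g.natDegree *
      ‖(g.map (Int.castRingHom ℂ)).eval ((x₁ : ℂ) / y₁)‖ := by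
    have h4 : (g.map (Int.castRingHom ℂ)).eval ((x₁ : ℂ) / y₁) =
        (((g.map (algebraMap ℤ ℚ)).eval ((x₁ : ℚ) / y₁) : ℚ) : ℂ) := by
      rw [← int_map_rat_map, algebraMap_int_eq, ← eq_ratCast (algebraMap ℚ ℂ), ← eval_map_apply]
      congr 1
      simp
    rw [h4, Complex.norm_ratCast]
    exact_mod_cast h2
  have hy₁R : (1 : ℝ) ≤ y₁ := by exact_mod_cast hy₁
  have hy₂R : (1 : ℝ) ≤ y₂ := by exact_mod_cast hy₂
  have h5 : ‖(g.map (Int.castRingHom ℂ)).eval ((x₁ : ℂ) / y₁)‖ ≤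
      (2 * (n + 1) * 3 ^ n * M ^ (n + 1) * H) *
      (y₂ * ‖(x₁ / y₁ : ℂ) - α i‖ ^ (k - j) + ‖α i * y₂ - x₂‖) := by
    set z : ℂ := (x₁ : ℂ) / y₁
    set A' := A.map (Int.castRingHom ℂ)
    set B' := B.map (Int.castRingHom ℂ)
    have hA' : A'.natDegree ≤ n := (natDegree_map_le).trans hA
    have hB' : B'.natDegree ≤ n := (natDegree_map_le).trans hB
    have hB'H (m : ℕ) : ‖B'.coeff m‖ ≤ H := by simpa [B'] using hBH m
    have hA'H (m : ℕ) : ‖A'.coeff m‖ ≤ H := by simpa [A'] using hAH m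
    have hz : ‖z‖ ≤ 2 * M := by
      have := norm_add_le (z - α i) (α i)
      rw [sub_add_cancel] at this
      linarith [hM i]
    have e1 : (g.map (Int.castRingHom ℂ)).eval z =
        y₂ * (hasseDeriv j (A' - C (α i) * B')).eval z +
          (α i * y₂ - x₂) * (hasseDeriv j B').eval z := by
      rw [hmap, map_sub, eval_sub, ← smul_eq_C_mul, (hasseDeriv j).map_smul, eval_smul,
        smul_eq_mul]
      ring
    have e2 := norm_eval_hasseDeriv_le_of_X_sub_C_pow_dvd (P := A' - C (α i) * B') (n := n)
      (H := 2 * M * H) (M := M) (w := α i) (z := z) (k := k) (l := j)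
      ((natDegree_sub_le _ _).trans (max_le hA' ((natDegree_C_mul_le _ _).trans hB')))
      (fun m => by
        rw [coeff_sub, coeff_C_mul]
        refine (norm_sub_le _ _).trans ?_
        rw [norm_mul]
        have := mul_le_mul (hM i) (hB'H m) (norm_nonneg _) (by linarith)
        nlinarith [hA'H m]) hM1 (hM i) hi (by omega) (hdvd i)
    have e3 := norm_eval_hasseDeriv_le hB' hB'H hM1 hz j
    have e4 : ((n : ℝ) + 1) * 3 ^ n * M ^ n * H ≤ 2 * (n + 1) * 3 ^ n * M ^ (n + 1) * H := by
      rw [pow_succ]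
      have : 0 ≤ ((n : ℝ) + 1) * 3 ^ n * M ^ n * H := by positivity
      nlinarith
    rw [e1]
    refine (norm_add_le _ _).trans ?_
    rw [norm_mul, norm_mul, mul_add]
    have hyn : ‖(y₂ : ℂ)‖ = y₂ := by
      rw [Complex.norm_intCast, abs_of_nonneg (by linarith)]
    rw [hyn]
    refine add_le_add ?_ ?_
    · calc _ ≤ (y₂ : ℝ) * ((n + 1) * 3 ^ n * M ^ n * (2 * M * H) * ‖z - α i‖ ^ (k - j)) := by
            gcongr
        _ = _ := by ring
    · rw [mul_comm]
      exact mul_le_mul_of_nonneg_right (e3.trans e4) (norm_nonneg _)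
  refine h3.trans ?_
  rw [mul_assoc]
  exact mul_le_mul (pow_le_pow_right₀ hy₁R hgdeg) h5 (norm_nonneg _) (by positivity)

variable {b c d e : ℤ} {α : Fin 4 → ℂ}

/-- Two very good rational approximations of the same root repel each other logarithmically. -/
theorem log_le_or_le_log (h : QuarticRoots b c d e α) (hα : Function.Injective α)
    (hrat : ∀ i (q : ℚ), α i ≠ q) {M : ℝ} (hM : ∀ i, ‖α i‖ ≤ M) (hM1 : 15 / 2 ≤ M)
    {x₁ y₁ x₂ y₂ : ℤ} (hxy : IsCoprime x₁ y₁) (hy₁ : M ^ 365 ≤ y₁) (hy₂ : 0 < y₂) (i : Fin 4)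
    (h₁ : ‖(x₁ : ℂ) - α i * y₁‖ * y₁ ^ 3 ≤ M ^ 2) (h₂ : ‖(x₂ : ℂ) - α i * y₂‖ * y₂ ^ 3 ≤ M ^ 2)
    {k n v s t u : ℕ} (hu : 2 * k = u * (n + 1 - 2 * k)) (hkn : 2 * k < n + 1) (hnk : n < 4 * k)
    (hvk : v < k) (hs : 8 * (n + 1) * 2 ^ n ≤ (15 / 2 : ℝ) ^ s)
    (ht : 4 * (n + 1) * 3 ^ n ≤ (15 / 2 : ℝ) ^ t) (hv : t + 2 * ((s + n + 4) * u) < 365 * v) :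
    365 * 3 * Real.log y₂ ≤ (365 * n + (t + n + 1 + (s + n + 4) * u + 2 * k)) * Real.log y₁ ∨
    (365 * (4 * k - n - 3 * v) - (t + n + 1 + (s + n + 4) * u + 2 * k)) * Real.log y₁ ≤
      365 * Real.log y₂ := by
  have hM0 : 0 < M := by linarith
  have hM1' : 1 < M := by linarith
  have hy₁R : (1 : ℝ) < y₁ := (one_lt_pow₀ hM1' (by norm_num)).trans_le hy₁
  have hy₁Z : 0 < y₁ := by
    have : (0 : ℝ) < y₁ := by linarith
    exact_mod_cast this
  have hy₁0 : (0 : ℝ) < y₁ := by linarith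
  have hy₂0 : (0 : ℝ) < y₂ := by exact_mod_cast hy₂
  set H : ℝ := M ^ ((s + n + 4) * u) with hHdef
  have hsM : 8 * (n + 1) * 2 ^ n ≤ M ^ s := hs.trans (pow_le_pow_left₀ (by norm_num) hM1 s)
  have htM : 4 * (n + 1) * 3 ^ n ≤ M ^ t := ht.trans (pow_le_pow_left₀ (by norm_num) hM1 t)
  have hH : (8 * (n + 1) * 2 ^ n * M ^ (n + 4)) ^ ((2 * k : ℝ) / (n + 1 - 2 * k)) ≤ H := by
    have hne : ((n : ℝ) + 1 - 2 * k) ≠ 0 := by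
      have : ((2 * k : ℕ) : ℝ) < ((n + 1 : ℕ) : ℝ) := by exact_mod_cast hkn
      push_cast at this; linarith
    have h3 : (2 * k : ℝ) / (n + 1 - 2 * k) = (u : ℕ) := by
      rw [div_eq_iff hne]
      have := congrArg (Nat.cast : ℕ → ℝ) hu
      rw [Nat.cast_mul, Nat.cast_mul, Nat.cast_sub hkn.le] at this
      push_cast at this
      exact this
    rw [h3, Real.rpow_natCast, hHdef, pow_mul, add_assoc, pow_add M s (n + 4)]
    gcongr
  have hδ : ‖(x₁ / y₁ : ℂ) - α i‖ ≤ M ^ 2 / (y₁ : ℝ) ^ 4 := by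
    have h3 : (x₁ / y₁ : ℂ) - α i = ((x₁ : ℂ) - α i * y₁) / y₁ := by
      have : (y₁ : ℂ) ≠ 0 := by exact_mod_cast hy₁Z.ne'
      field_simp
    rw [h3, norm_div, Complex.norm_intCast, abs_of_pos hy₁0, div_le_div_iff₀ hy₁0 (by positivity)]
    nlinarith
  have hε : ‖α i * y₂ - x₂‖ ≤ M ^ 2 / (y₂ : ℝ) ^ 3 := by
    rwa [norm_sub_rev, le_div_iff₀ (by positivity)]
  have hδ1 : M ^ 2 / (y₁ : ℝ) ^ 4 ≤ 1 := by
    rw [div_le_one (by positivity)]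
    calc M ^ 2 ≤ M ^ 365 := pow_le_pow_right₀ hM1'.le (by norm_num)
      _ ≤ y₁ := hy₁
      _ ≤ (y₁ : ℝ) ^ 4 := le_self_pow₀ hy₁R.le (by norm_num)
  have hvy : 4 * (n + 1) ^ 2 * H ^ 2 < (y₁ : ℝ) ^ v := by
    have h3 : (n + 1 : ℝ) ≤ 3 ^ n := by
      have : n + 1 ≤ 3 ^ n := Nat.lt_pow_self (by norm_num)
      exact_mod_cast this
    calc 4 * (n + 1) ^ 2 * H ^ 2 = 4 * (n + 1) * (n + 1) * H ^ 2 := by ring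
      _ ≤ 4 * (n + 1) * 3 ^ n * H ^ 2 := by gcongr
      _ ≤ M ^ t * H ^ 2 := by gcongr
      _ = M ^ (t + 2 * ((s + n + 4) * u)) := by rw [hHdef, pow_add, ← pow_mul]; ring
      _ < M ^ (365 * v) := pow_lt_pow_right₀ hM1' hv
      _ ≤ (y₁ : ℝ) ^ v := by rw [pow_mul]; gcongr
  obtain ⟨j, hj, hj1⟩ := h.exists_one_le_pow_mul (x₂ := x₂) hα hrat hM hM1'.le hkn hnk hvk hH hxy hy₁Z hy₂ hvy
    i (hδ.trans hδ1)
  obtain ⟨k', hk'⟩ := Nat.exists_eq_add_of_le (by omega : j ≤ k)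
  obtain ⟨n', hn'⟩ := Nat.exists_eq_add_of_le (by omega : j ≤ n)
  rw [show k - j = k' by omega, show n - j = n' by omega] at hj1
  set κ : ℕ := t + n + 1 + (s + n + 4) * u with hκ
  have hK : 2 * (n + 1) * 3 ^ n * M ^ (n + 1) * H ≤ M ^ κ / 2 := by
    have h3 : M ^ κ = M ^ t * (M ^ (n + 1) * H) := by
      rw [hHdef, hκ, add_assoc t, pow_add, pow_add]; ring
    rw [h3]
    have := mul_le_mul_of_nonneg_right htM (by positivity : 0 ≤ M ^ (n + 1) * H)
    linarith
  have h4 : 1 ≤ (y₁ : ℝ) ^ n' * (M ^ κ / 2) *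
      (y₂ * (M ^ 2 / (y₁ : ℝ) ^ 4) ^ k' + M ^ 2 / (y₂ : ℝ) ^ 3) := by
    refine hj1.trans ?_
    gcongr
  have hm : 365 * Real.log M ≤ Real.log y₁ := by
    have := Real.log_le_log (by positivity) hy₁
    rwa [Real.log_pow] at this
  have hm0 : 0 < Real.log M := Real.log_pos hM1'
  have hvR : (j : ℝ) ≤ v := by exact_mod_cast hj
  have hnR : (n : ℝ) = j + n' := by rw [hn']; push_cast; ring
  have hkR : (k : ℝ) = j + k' := by rw [hk']; push_cast; ring
  have hκR : (κ : ℝ) = t + n + 1 + (s + n + 4) * u := by simp [hκ]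
  have hk1 : (1 : ℝ) ≤ k := by exact_mod_cast (by omega : 1 ≤ k)
  rw [← hκR]
  have hor : 1 ≤ (y₁ : ℝ) ^ n' * M ^ κ * (y₂ * (M ^ 2 / (y₁ : ℝ) ^ 4) ^ k') ∨
      1 ≤ (y₁ : ℝ) ^ n' * M ^ κ * (M ^ 2 / (y₂ : ℝ) ^ 3) := by
    by_contra! hcon
    nlinarith [hcon.1, hcon.2]
  have hL : 0 < Real.log y₁ := Real.log_pos hy₁R
  have hκm : ((κ : ℝ) + 2 * k) * (365 * Real.log M) ≤ (κ + 2 * k) * Real.log y₁ := by gcongr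
  rcases hor with h5 | h5
  · right
    have h6 := Real.log_nonneg h5
    rw [Real.log_mul (by positivity) (by positivity), Real.log_mul (by positivity) (by positivity),
      Real.log_mul (by positivity) (by positivity), Real.log_pow, Real.log_pow, Real.log_pow,
      Real.log_div (by positivity) (by positivity), Real.log_pow, Real.log_pow] at h6
    push_cast at h6
    have h7 : (0 : ℝ) ≤ (v - j) * Real.log y₁ := mul_nonneg (by linarith) hL.le
    have h8 : (0 : ℝ) ≤ j * Real.log M := by positivity
    rw [hnR, hkR]
    rw [hkR] at hκm
    linear_combination 365 * h6 + hκm + 1095 * h7 + 730 * h8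
  · left
    have h6 := Real.log_nonneg h5
    rw [Real.log_mul (by positivity) (by positivity), Real.log_mul (by positivity) (by positivity),
      Real.log_pow, Real.log_pow,
      Real.log_div (by positivity) (by positivity), Real.log_pow, Real.log_pow] at h6
    push_cast at h6
    have h7 : (0 : ℝ) ≤ j * Real.log y₁ := by positivity
    have h8 : 0 ≤ (k - 1) * Real.log M := mul_nonneg (by linarith) hm0.le
    rw [hnR]
    linear_combination 365 * h6 + hκm + 365 * h7 + 730 * h8

/-- Thue's method: three-fold growth between huge approximations of the same root is impossible. -/
theorem not_huge_approximations (h : QuarticRoots b c d e α) (hα : Function.Injective α)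
    (hrat : ∀ i (q : ℚ), α i ≠ q) {M : ℝ} (hM : ∀ i, ‖α i‖ ≤ M) (hM1 : 15 / 2 ≤ M)
    {x₁ y₁ x₂ y₂ : ℤ} (hxy : IsCoprime x₁ y₁) (hy₁ : M ^ 365 ≤ y₁)
    (hy₁₂ : (y₁ : ℝ) ^ 3 ≤ y₂ * M ^ 2) (i : Fin 4)
    (h₁ : ‖(x₁ : ℂ) - α i * y₁‖ * y₁ ^ 3 ≤ M ^ 2) (h₂ : ‖(x₂ : ℂ) - α i * y₂‖ * y₂ ^ 3 ≤ M ^ 2) :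
    False := by
  have hM0 : 0 < M := by linarith
  have hy₁R : (1 : ℝ) < y₁ := (one_lt_pow₀ (by linarith) (by norm_num)).trans_le hy₁
  have hy₂0 : (0 : ℝ) < y₂ := by
    have : 0 < (y₁ : ℝ) ^ 3 := by positivity
    exact pos_of_mul_pos_left (this.trans_le hy₁₂) (by positivity)
  have hy₂ : 0 < y₂ := by exact_mod_cast hy₂0
  have hm : 365 * Real.log M ≤ Real.log y₁ := by
    have := Real.log_le_log (by positivity) hy₁
    rwa [Real.log_pow] at this
  have hL : 0 < Real.log y₁ := Real.log_pos hy₁R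
  have hθ : 3 * Real.log y₁ ≤ Real.log y₂ + 2 * Real.log M := by
    have := Real.log_le_log (by positivity) hy₁₂
    rw [Real.log_pow, Real.log_mul hy₂0.ne' (by positivity), Real.log_pow] at this
    exact_mod_cast this
  have key := @log_le_or_le_log _ _ _ _ _ h hα hrat M hM hM1 x₁ y₁ x₂ y₂ hxy hy₁ hy₂ i h₁ h₂
  set L := Real.log y₁
  set L₂ := Real.log y₂
  have w1 := key (k := 4) (n := 8) (v := 1) (s := 5) (t := 7) (u := 8) (by norm_num) (by norm_num)
    (by norm_num) (by norm_num) (by norm_num) (by norm_num) (by norm_num)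
  have w2 := key (k := 5) (n := 11) (v := 1) (s := 7) (t := 8) (u := 5) (by norm_num) (by norm_num)
    (by norm_num) (by norm_num) (by norm_num) (by norm_num) (by norm_num)
  have w (u v : ℕ) (hu : 3 ≤ u) (hv : 67 * u + 25 < 365 * v) (hvu : v < 2 * u) :
      3 * 365 * L₂ ≤ (1869 * u - 352) * L ∨ (1051 * u + 352 - 1095 * v) * L ≤ 365 * L₂ := by
    have growth : 20 * (u : ℝ) ≤ 13 ^ u ∧ 20 * (u : ℝ) ≤ 22 * (421 / 243) ^ u := by
      clear hv hvu
      induction u, hu using Nat.le_induction with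
      | base => norm_num
      | succ u hu ih =>
        have : (3 : ℝ) ≤ u := by exact_mod_cast hu
        rw [pow_succ, pow_succ]
        push_cast
        constructor <;> linarith [ih.1, ih.2]
    obtain ⟨u', rfl⟩ := Nat.exists_eq_succ_of_ne_zero (by omega : u ≠ 0)
    have h5 : (15 / 2 : ℝ) ^ (3 * (u' + 1)) = (3375 / 8) ^ (u' + 1) := by rw [pow_mul]; norm_num
    have := key (k := 2 * (u' + 1)) (n := 5 * u' + 4) (v := v) (s := 3 * (u' + 1))
      (t := 3 * (u' + 1) + 1) (u := 4) (by omega) (by omega) (by omega) hvu ?_ ?_ (by omega)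
    · push_cast at this ⊢
      rcases this with h5 | h5
      · left; linarith
      · right; linarith
    · rw [h5]
      calc (8 * (((5 * u' + 4 : ℕ) : ℝ) + 1) * 2 ^ (5 * u' + 4))
          = 20 * ((u' + 1 : ℕ) : ℝ) * 32 ^ (u' + 1) := by
            rw [show (32 : ℝ) = 2 ^ 5 by norm_num, ← pow_mul]; push_cast; ring
        _ ≤ 13 ^ (u' + 1) * 32 ^ (u' + 1) := by gcongr; exact growth.1
        _ ≤ (3375 / 8) ^ (u' + 1) := by rw [← mul_pow]; gcongr; norm_num
    · rw [pow_succ (15 / 2 : ℝ), h5]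
      calc (4 * (((5 * u' + 4 : ℕ) : ℝ) + 1) * 3 ^ (5 * u' + 4))
          = (20 * ((u' + 1 : ℕ) : ℝ)) * 243 ^ (u' + 1) / 3 := by
            rw [show (243 : ℝ) = 3 ^ 5 by norm_num, ← pow_mul]; push_cast; ring
        _ ≤ (22 * (421 / 243) ^ (u' + 1)) * 243 ^ (u' + 1) / 3 := by
            have := mul_le_mul_of_nonneg_right growth.2 (by positivity : (0 : ℝ) ≤ 243 ^ (u' + 1))
            exact div_le_div_of_nonneg_right this (by norm_num)
        _ = 421 ^ (u' + 1) * (22 / 3) := by rw [div_pow]; field_simp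
        _ ≤ (3375 / 8) ^ (u' + 1) * (15 / 2) :=
            mul_le_mul (pow_le_pow_left₀ (by norm_num) (by norm_num) _) (by norm_num) (by norm_num)
              (by positivity)
  have w3 := w 3 1 (by norm_num) (by norm_num) (by norm_num)
  have w4 := w 4 1 (by norm_num) (by norm_num) (by norm_num)
  have w5 := w 5 1 (by norm_num) (by norm_num) (by norm_num)
  norm_num at w1 w2 w3 w4 w5
  replace w1 := w1.resolve_left (by intro; linarith)
  replace w2 := w2.resolve_left (by intro; linarith)
  replace w3 := w3.resolve_left (by intro; linarith)
  replace w4 := w4.resolve_left (by intro; linarith)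
  replace w5 := w5.resolve_left (by intro; linarith)
  have climb (u : ℕ) (hu : 6 ≤ u) : (850 * u - 818) * L ≤ 365 * L₂ := by
    induction u, hu using Nat.le_induction with
    | base => norm_num; linarith
    | succ u hu ih =>
      obtain ⟨v, hv⟩ : ∃ v, v = (67 * (u + 1) + 25) / 365 + 1 := ⟨_, rfl⟩
      have huR : (6 : ℝ) ≤ u := by exact_mod_cast hu
      have hvR : 365 * (v : ℝ) ≤ 67 * (u + 1) + 25 + 365 := by
        have : 365 * v ≤ 67 * (u + 1) + 25 + 365 := by omega
        exact_mod_cast this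
      rcases w (u + 1) v (by omega) (by omega) (by omega) with h5 | h5
      · push_cast at h5 ⊢
        nlinarith
      · push_cast at h5 ⊢
        nlinarith
  obtain ⟨u, hu⟩ := exists_nat_gt (365 * L₂ / L)
  rw [div_lt_iff₀ hL] at hu
  have h5 := climb (u + 6) (by omega)
  push_cast at h5
  have : 0 ≤ (u : ℝ) * L := by positivity
  linarith

variable {b c d e : ℤ} {α : Fin 4 → ℂ}

theorem quarticEval_eq (h : QuarticRoots b c d e α) (x y : ℤ) :
    (quarticEval 1 b c d e x y : ℂ) = ∏ i, ((x : ℂ) - α i * y) := by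
  rw [h.prod_sub, quarticEval]; push_cast; ring

theorem quarticDisc_eq (h : QuarticRoots b c d e α) :
    (quarticDisc 1 b c d e : ℂ) = ((α 0 - α 1) * (α 0 - α 2) * (α 0 - α 3) * (α 1 - α 2) *
      (α 1 - α 3) * (α 2 - α 3)) ^ 2 := by
  have h1 : (b : ℂ) = -(α 0 + α 1 + α 2 + α 3) := by rw [h.sum_one]; ring
  have h3 : (d : ℂ) = -(α 0 * α 1 * α 2 + α 0 * α 1 * α 3 + α 0 * α 2 * α 3
    + α 1 * α 2 * α 3) := by rw [h.sum_three]; ring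
  rw [quarticDisc]
  push_cast
  rw [h1, h3, ← h.sum_two, ← h.prod]
  ring

theorem abs_quarticDisc_eq (h : QuarticRoots b c d e α) :
    |(quarticDisc 1 b c d e : ℝ)| = (‖α 0 - α 1‖ * ‖α 0 - α 2‖ * ‖α 0 - α 3‖ * ‖α 1 - α 2‖ *
      ‖α 1 - α 3‖ * ‖α 2 - α 3‖) ^ 2 := by
  rw [← Complex.norm_intCast, h.quarticDisc_eq]
  simp only [norm_pow, norm_mul]

theorem injective_of_quarticDisc_ne_zero (h : QuarticRoots b c d e α)
    (hD : quarticDisc 1 b c d e ≠ 0) : Function.Injective α := by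
  have h1 : (quarticDisc 1 b c d e : ℂ) ≠ 0 := by exact_mod_cast hD
  rw [h.quarticDisc_eq, pow_ne_zero_iff (by norm_num)] at h1
  simp only [mul_ne_zero_iff, sub_ne_zero] at h1
  intro i j hij
  fin_cases i <;> fin_cases j <;> simp_all [eq_comm]

theorem abs_quarticDisc_le (h : QuarticRoots b c d e α) {ρ : Fin 4 → ℝ} {B : ℝ}
    (hρ : ∀ i, 0 ≤ ρ i) (hB : 0 ≤ B) (hle : ∀ i j, ‖α i - α j‖ ≤ B * (ρ i * ρ j)) :
    |(quarticDisc 1 b c d e : ℝ)| ≤ B ^ 12 * (∏ i, ρ i) ^ 6 := by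
  rw [h.abs_quarticDisc_eq]
  have h0 := hρ 0
  have h1 := hρ 1
  have h2 := hρ 2
  have h3 := hρ 3
  calc _ ≤ (B * (ρ 0 * ρ 1) * (B * (ρ 0 * ρ 2)) * (B * (ρ 0 * ρ 3)) * (B * (ρ 1 * ρ 2)) *
      (B * (ρ 1 * ρ 3)) * (B * (ρ 2 * ρ 3))) ^ 2 := by gcongr <;> apply hle
    _ = _ := by rw [Fin.prod_univ_four]; ring

end QuarticRoots

theorem norm_sub_le_two_mul_max (z w : ℂ) : ‖z - w‖ ≤ 2 * (max 1 ‖z‖ * max 1 ‖w‖) := by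
  have h1 := norm_sub_le z w
  have h2 := le_max_left 1 ‖z‖
  have h3 := le_max_right 1 ‖z‖
  have h4 := le_max_left 1 ‖w‖
  have h5 := le_max_right 1 ‖w‖
  nlinarith

/-- The Mahler measure of the monic polynomial with roots `α i`. -/
noncomputable def rootHeight (α : Fin 4 → ℂ) : ℝ := ∏ i, max 1 ‖α i‖

theorem one_le_rootHeight (α : Fin 4 → ℂ) : 1 ≤ rootHeight α :=
  Finset.one_le_prod fun _ _ => le_max_left _ _

theorem norm_le_rootHeight (α : Fin 4 → ℂ) (i : Fin 4) : ‖α i‖ ≤ rootHeight α := by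
  rw [rootHeight, ← Finset.mul_prod_erase _ _ (Finset.mem_univ i)]
  exact (le_max_right 1 _).trans (le_mul_of_one_le_right (by positivity)
    (Finset.one_le_prod fun _ _ => le_max_left _ _))

namespace QuarticRoots

variable {b c d e : ℤ} {α : Fin 4 → ℂ}

theorem abs_quarticDisc_le_rootHeight (h : QuarticRoots b c d e α) :
    |(quarticDisc 1 b c d e : ℝ)| ≤ 4096 * rootHeight α ^ 6 := by
  have := h.abs_quarticDisc_le (ρ := fun i => max 1 ‖α i‖) (B := 2) (fun i => by positivity)
    (by norm_num) fun i j => norm_sub_le_two_mul_max _ _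
  norm_num at this
  exact this

theorem le_rootHeight (h : QuarticRoots b c d e α)
    (hD : (7 / 2 : ℝ) ^ 12 * 4 ^ 4 < |(quarticDisc 1 b c d e : ℝ)|) : 15 / 2 ≤ rootHeight α := by
  by_contra! hlt
  have h1 := h.abs_quarticDisc_le_rootHeight
  have h2 : rootHeight α ^ 6 ≤ (15 / 2) ^ 6 :=
    pow_le_pow_left₀ (zero_le_one.trans (one_le_rootHeight α)) hlt.le 6
  norm_num at hD h2
  linarith

/-- A solution is a good approximation of the nearest root. -/
theorem exists_norm_sub_mul_le (h : QuarticRoots b c d e α)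
    (hD : (7 / 2 : ℝ) ^ 12 * 4 ^ 4 < |(quarticDisc 1 b c d e : ℝ)|) {x y : ℤ} (hy : 0 < y)
    (hxy : |quarticEval 1 b c d e x y| = 1) :
    ∃ i, ‖(x : ℂ) - α i * y‖ * y ^ 3 ≤ rootHeight α ^ 2 / 2 := by
  obtain ⟨i, -, hi⟩ := Finset.exists_min_image Finset.univ (fun i => ‖(x : ℂ) - α i * y‖)
    Finset.univ_nonempty
  refine ⟨i, ?_⟩
  have hy0 : (0 : ℝ) < y := by exact_mod_cast hy
  have hprod : ∏ i, ‖(x : ℂ) - α i * y‖ = 1 := by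
    rw [← norm_prod, ← h.quarticEval_eq, Complex.norm_intCast]
    exact_mod_cast hxy
  have hle (j : Fin 4) : ‖α i - α j‖ * y ≤ 2 * ‖(x : ℂ) - α j * y‖ := by
    have h1 := norm_sub_le ((x : ℂ) - α j * y) ((x : ℂ) - α i * y)
    have h2 : ((x : ℂ) - α j * y) - ((x : ℂ) - α i * y) = (α i - α j) * y := by ring
    rw [h2, norm_mul, Complex.norm_intCast, abs_of_pos hy0] at h1
    linarith [hi j (Finset.mem_univ j)]
  have hn (j k : Fin 4) := norm_sub_le_two_mul_max (α j) (α k)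
  have hM : rootHeight α = max 1 ‖α 0‖ * max 1 ‖α 1‖ * max 1 ‖α 2‖ * max 1 ‖α 3‖ :=
    Fin.prod_univ_four _
  set m : Fin 4 → ℝ := fun i => max 1 ‖α i‖ with hm
  have hm1 (i : Fin 4) : 1 ≤ m i := le_max_left _ _
  set N : Fin 4 → Fin 4 → ℝ := fun i j => ‖α i - α j‖ with hN
  set l : Fin 4 → ℝ := fun i => ‖(x : ℂ) - α i * y‖ with hl
  have hN0 (i j : Fin 4) : 0 ≤ N i j := norm_nonneg _
  have hl0 (i : Fin 4) : 0 ≤ l i := norm_nonneg _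
  have hNs (i j : Fin 4) : N i j = N j i := norm_sub_rev _ _
  have hDN := h.abs_quarticDisc_eq
  rw [Fin.prod_univ_four] at hprod
  change l 0 * l 1 * l 2 * l 3 = 1 at hprod
  change _ = (N 0 1 * N 0 2 * N 0 3 * N 1 2 * N 1 3 * N 2 3) ^ 2 at hDN
  change rootHeight α = m 0 * m 1 * m 2 * m 3 at hM
  change ∀ j, N i j * y ≤ 2 * l j at hle
  change ∀ j k, N j k ≤ 2 * (m j * m k) at hn
  change l i * y ^ 3 ≤ _
  have hsq : 128 ≤ N 0 1 * N 0 2 * N 0 3 * N 1 2 * N 1 3 * N 2 3 := by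
    by_contra! hlt
    have h1 : (N 0 1 * N 0 2 * N 0 3 * N 1 2 * N 1 3 * N 2 3) ^ 2 ≤ 128 ^ 2 :=
      pow_le_pow_left₀ (by positivity) hlt.le 2
    rw [← hDN] at h1
    norm_num at hD h1
    linarith
  -- the product over the pairs through `i` and the product over the remaining pairs
  have key (i j k t : Fin 4) (hle : ∀ j, N i j * y ≤ 2 * l j) (hp : l i * (l j * l k * l t) = 1)
      (hM : rootHeight α = m i * (m j * m k * m t))
      (hs : 128 ≤ (N i j * N i k * N i t) * (N j k * N j t * N k t)) :
      l i * y ^ 3 ≤ rootHeight α ^ 2 / 2 := by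
    have h1 : N j k * N j t * N k t ≤ 8 * rootHeight α ^ 2 := by
      calc _ ≤ (2 * (m j * m k)) * (2 * (m j * m t)) * (2 * (m k * m t)) := by
            have hjk := (hN0 j k).trans (hn j k)
            have hjt := (hN0 j t).trans (hn j t)
            exact mul_le_mul (mul_le_mul (hn j k) (hn j t) (hN0 _ _) hjk) (hn k t) (hN0 _ _)
              (mul_nonneg hjk hjt)
        _ = 8 * (m j * m k * m t) ^ 2 := by ring
        _ ≤ 8 * rootHeight α ^ 2 := by
            have := hm1 j
            have := hm1 k
            have := hm1 t
            rw [hM]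
            have h1 : m j * m k * m t ≤ m i * (m j * m k * m t) :=
              le_mul_of_one_le_left (by positivity) (hm1 i)
            exact mul_le_mul_of_nonneg_left (pow_le_pow_left₀ (by positivity) h1 2) (by norm_num)
    have h2 : (N i j * y) * (N i k * y) * (N i t * y) ≤ 8 * (l j * l k * l t) := by
      calc _ ≤ (2 * l j) * (2 * l k) * (2 * l t) := by
            have hN1 (j : Fin 4) : 0 ≤ N i j * y := mul_nonneg (hN0 _ _) hy0.le
            exact mul_le_mul (mul_le_mul (hle j) (hle k) (hN1 _) ((hN1 j).trans (hle j))) (hle t)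
              (hN1 _) (mul_nonneg ((hN1 j).trans (hle j)) ((hN1 k).trans (hle k)))
        _ = _ := by ring
    have h3 : l i * ((N i j * y) * (N i k * y) * (N i t * y)) ≤ 8 := by
      have := mul_le_mul_of_nonneg_left h2 (hl0 i)
      linarith
    have h4 : 0 ≤ l i * y ^ 3 := by have := hl0 i; positivity
    have h5 : 0 ≤ N i j * N i k * N i t :=
      mul_nonneg (mul_nonneg (hN0 _ _) (hN0 _ _)) (hN0 _ _)
    have h6 : 128 ≤ (N i j * N i k * N i t) * (8 * rootHeight α ^ 2) :=
      hs.trans (mul_le_mul_of_nonneg_left h1 h5)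
    have h7 : l i * y ^ 3 * 128 ≤ l i * y ^ 3 * ((N i j * N i k * N i t) * (8 * rootHeight α ^ 2)) :=
      mul_le_mul_of_nonneg_left h6 h4
    have h8 := mul_le_mul_of_nonneg_right h3 (by positivity : 0 ≤ 8 * rootHeight α ^ 2)
    linarith
  fin_cases i
  · exact key 0 1 2 3 hle (by linarith) (by linarith) (by linarith)
  · exact key 1 0 2 3 hle (by linarith) (by linarith) (by rw [hNs 1 0]; linarith)
  · exact key 2 0 1 3 hle (by linarith) (by linarith) (by rw [hNs 2 0, hNs 2 1]; linarith)
  · exact key 3 0 1 2 hle (by linarith) (by linarith)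
      (by rw [hNs 3 0, hNs 3 1, hNs 3 2]; linarith)

end QuarticRoots

theorem isCoprime_of_abs_quarticEval_eq_one {a b c d e x y : ℤ}
    (h : |quarticEval a b c d e x y| = 1) : IsCoprime x y := by
  refine ⟨quarticEval a b c d e x y * (a * x ^ 3 + b * x ^ 2 * y + c * x * y ^ 2 + d * y ^ 3),
    quarticEval a b c d e x y * (e * y ^ 3), ?_⟩
  have h1 : quarticEval a b c d e x y * quarticEval a b c d e x y = 1 := by
    rw [← abs_mul_abs_self, h]; norm_num
  nth_rw 2 [quarticEval] at h1
  linear_combination h1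

theorem eq_of_mul_eq_mul_of_isCoprime {x₁ y₁ x₂ y₂ : ℤ} (h₁ : IsCoprime x₁ y₁)
    (h₂ : IsCoprime x₂ y₂) (hy₁ : 0 < y₁) (hy₂ : 0 < y₂) (h : x₁ * y₂ = x₂ * y₁) :
    x₁ = x₂ ∧ y₁ = y₂ := by
  have hy : y₁ = y₂ := Int.dvd_antisymm hy₁.le hy₂.le
    (h₁.symm.dvd_of_dvd_mul_left ⟨x₂, by linarith⟩) (h₂.symm.dvd_of_dvd_mul_left ⟨x₁, by linarith⟩)
  subst hy
  exact ⟨mul_right_cancel₀ hy₁.ne' h, rfl⟩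

/-- Iterating a cubic gap principle. -/
theorem exists_pow_le_of_gap {ι : Type*} [DecidableEq ι] {M : ℝ} (hM : 1 ≤ M) (y : ι → ℝ) (n : ℕ)
    (T : Finset ι) (hT : T.card = n + 1) (hpos : ∀ p ∈ T, 0 < y p) (hlarge : ∀ p ∈ T, M ^ 3 ≤ y p ^ 2)
    (hgap : ∀ p ∈ T, ∀ q ∈ T, p ≠ q → y p ≤ y q → y p ^ 3 ≤ y q * M ^ 2) :
    ∃ q ∈ T, (∀ p ∈ T, y p ≤ y q) ∧ M ^ (2 + 3 ^ n) ≤ y q ^ 2 := by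
  induction n generalizing T with
  | zero =>
    obtain ⟨q, hq, hmax⟩ := T.exists_max_image y (Finset.card_pos.mp (by omega))
    exact ⟨q, hq, hmax, hlarge q hq⟩
  | succ n ih =>
    obtain ⟨q, hq, hmax⟩ := T.exists_max_image y (Finset.card_pos.mp (by omega))
    refine ⟨q, hq, hmax, ?_⟩
    have hsub {p : ι} (hp : p ∈ T.erase q) : p ∈ T := Finset.mem_of_mem_erase hp
    obtain ⟨p, hp, -, hle⟩ := ih (T.erase q) (by rw [Finset.card_erase_of_mem hq]; omega)
      (fun p hp => hpos p (hsub hp)) (fun p hp => hlarge p (hsub hp))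
      (fun p hp q hq => hgap p (hsub hp) q (hsub hq))
    have h1 := hgap p (hsub hp) q hq (Finset.ne_of_mem_erase hp) (hmax p (hsub hp))
    have h2 := hpos p (hsub hp)
    refine le_of_mul_le_mul_right ?_ (by positivity : 0 < M ^ 4)
    calc M ^ (2 + 3 ^ (n + 1)) * M ^ 4 = (M ^ (2 + 3 ^ n)) ^ 3 := by
          rw [← pow_add, ← pow_mul]; congr 1; ring
      _ ≤ (y p ^ 2) ^ 3 := by gcongr
      _ = (y p ^ 3) ^ 2 := by ring
      _ ≤ (y q * M ^ 2) ^ 2 := by gcongr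
      _ = y q ^ 2 * M ^ 4 := by ring

namespace QuarticRoots

variable {b c d e : ℤ} {α : Fin 4 → ℂ}

/-- Two solutions close to the same root satisfy a cubic gap principle. -/
theorem pow_three_le_mul {M : ℝ} {x₁ y₁ x₂ y₂ : ℤ} (hne : x₁ * y₂ ≠ x₂ * y₁)
    (hy₁ : 0 < y₁) (hy₁₂ : y₁ ≤ y₂) (i : Fin 4)
    (h₁ : ‖(x₁ : ℂ) - α i * y₁‖ * y₁ ^ 3 ≤ M ^ 2 / 2)
    (h₂ : ‖(x₂ : ℂ) - α i * y₂‖ * y₂ ^ 3 ≤ M ^ 2 / 2) : (y₁ : ℝ) ^ 3 ≤ y₂ * M ^ 2 := by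
  have hy₁' : (0 : ℝ) < y₁ := by exact_mod_cast hy₁
  have hy₁₂' : (y₁ : ℝ) ≤ y₂ := by exact_mod_cast hy₁₂
  have hdet : 1 ≤ ‖(x₁ : ℂ) - α i * y₁‖ * y₂ + ‖(x₂ : ℂ) - α i * y₂‖ * y₁ := by
    have h3 : (1 : ℝ) ≤ ‖((x₁ * y₂ - x₂ * y₁ : ℤ) : ℂ)‖ := by
      rw [Complex.norm_intCast]
      exact_mod_cast Int.one_le_abs (sub_ne_zero.mpr hne)
    have h4 : ((x₁ * y₂ - x₂ * y₁ : ℤ) : ℂ) =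
        ((x₁ : ℂ) - α i * y₁) * y₂ - ((x₂ : ℂ) - α i * y₂) * y₁ := by push_cast; ring
    have h5 := norm_sub_le (((x₁ : ℂ) - α i * y₁) * y₂) (((x₂ : ℂ) - α i * y₂) * y₁)
    rw [h4] at h3
    rw [norm_mul, norm_mul, Complex.norm_intCast, Complex.norm_intCast, abs_of_pos hy₁',
      abs_of_pos (hy₁'.trans_le hy₁₂')] at h5
    linarith
  have h2' : ‖(x₂ : ℂ) - α i * y₂‖ * y₁ ^ 3 ≤ M ^ 2 / 2 :=
    (mul_le_mul_of_nonneg_left (pow_le_pow_left₀ hy₁'.le hy₁₂' 3) (norm_nonneg _)).trans h₂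
  have h3 := mul_le_mul_of_nonneg_left h2' hy₁'.le
  have h4 := mul_le_mul_of_nonneg_left h₁ (hy₁'.le.trans hy₁₂')
  have h5 := mul_le_mul_of_nonneg_left hdet (by positivity : 0 ≤ (y₁ : ℝ) ^ 3)
  have h6 := mul_le_mul_of_nonneg_right hy₁₂' (by positivity : 0 ≤ M ^ 2 / 2)
  linarith

theorem card_large_le (h : QuarticRoots b c d e α)
    (hrat : ∀ i (q : ℚ), α i ≠ q)
    (hD : (7 / 2 : ℝ) ^ 12 * 4 ^ 4 < |(quarticDisc 1 b c d e : ℝ)|) (T : Finset (ℤ × ℤ))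
    (hpos : ∀ p ∈ T, 0 < p.2) (hone : ∀ p ∈ T, |quarticEval 1 b c d e p.1 p.2| = 1)
    (hlarge : ∀ p ∈ T, rootHeight α ^ 3 ≤ (p.2 : ℝ) ^ 2) : T.card ≤ 28 := by
  have hM := h.le_rootHeight hD
  set M := rootHeight α with hMdef
  have hα : Function.Injective α := h.injective_of_quarticDisc_ne_zero (by
    rintro h0; rw [h0] at hD; norm_num at hD)
  let U (i : Fin 4) := T.filter fun p => ‖(p.1 : ℂ) - α i * p.2‖ * p.2 ^ 3 ≤ M ^ 2 / 2
  have hTU : T ⊆ Finset.univ.biUnion U := by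
    intro p hp
    obtain ⟨i, hi⟩ := h.exists_norm_sub_mul_le hD (hpos p hp) (hone p hp)
    exact Finset.mem_biUnion.mpr ⟨i, Finset.mem_univ i, Finset.mem_filter.mpr ⟨hp, hi⟩⟩
  have hU (i : Fin 4) : (U i).card ≤ 7 := by
    by_contra! hlt
    obtain ⟨V, hVU, hV⟩ := Finset.exists_subset_card_eq (show 8 ≤ (U i).card from hlt)
    have hVT {p : ℤ × ℤ} (hp : p ∈ V) : p ∈ T := (Finset.mem_filter.mp (hVU hp)).1
    have hVi {p : ℤ × ℤ} (hp : p ∈ V) := (Finset.mem_filter.mp (hVU hp)).2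
    obtain ⟨q, hq, hmax⟩ := V.exists_max_image Prod.snd (Finset.card_pos.mp (by omega))
    have hgap (p) (hp : p ∈ V) (q) (hq : q ∈ V) (hpq : p ≠ q) (hle : (p.2 : ℝ) ≤ q.2) :
        (p.2 : ℝ) ^ 3 ≤ q.2 * M ^ 2 := by
      refine pow_three_le_mul (fun heq => hpq ?_) (hpos p (hVT hp)) (by exact_mod_cast hle) i (hVi hp) (hVi hq)
      obtain ⟨h1, h2⟩ := eq_of_mul_eq_mul_of_isCoprime
        (isCoprime_of_abs_quarticEval_eq_one (hone p (hVT hp)))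
        (isCoprime_of_abs_quarticEval_eq_one (hone q (hVT hq))) (hpos p (hVT hp))
        (hpos q (hVT hq)) heq
      exact Prod.ext h1 h2
    have hsub {p : ℤ × ℤ} (hp : p ∈ V.erase q) : p ∈ V := Finset.mem_of_mem_erase hp
    obtain ⟨p, hp, -, hple⟩ := exists_pow_le_of_gap (M := M) (by linarith)
      (fun p : ℤ × ℤ => (p.2 : ℝ)) 6 (V.erase q) (by rw [Finset.card_erase_of_mem hq, hV])
      (fun p hp => by exact_mod_cast hpos p (hVT (hsub hp)))
      (fun p hp => hlarge p (hVT (hsub hp)))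
      (fun p hp q hq => hgap p (hsub hp) q (hsub hq))
    have hp0 : (0 : ℝ) < p.2 := by exact_mod_cast hpos p (hVT (hsub hp))
    have hp365 : M ^ 365 ≤ p.2 := by
      refine le_of_sq_le_sq ?_ hp0.le
      rw [← pow_mul]
      exact (pow_le_pow_right₀ (by linarith) (by norm_num)).trans hple
    have hhalf : M ^ 2 / 2 ≤ M ^ 2 := by linarith [sq_nonneg M]
    exact h.not_huge_approximations hα hrat (norm_le_rootHeight α) hM
      (isCoprime_of_abs_quarticEval_eq_one (hone p (hVT (hsub hp)))) hp365
      (hgap p (hsub hp) q hq (Finset.ne_of_mem_erase hp)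
        (by exact_mod_cast hmax p (hsub hp))) i ((hVi (hsub hp)).trans hhalf)
      ((hVi hq).trans hhalf)
  calc T.card ≤ (Finset.univ.biUnion U).card := Finset.card_le_card hTU
    _ ≤ Finset.univ.card * 7 := Finset.card_biUnion_le_card_mul _ _ _ fun i _ => hU i
    _ = 28 := rfl

end QuarticRoots

/-- Multiplicative telescoping along a finite set ordered by `y`. -/
theorem exists_prod_erase_le {ι : Type*} [DecidableEq ι] (y w : ι → ℝ) (X : Finset ι)
    (hX : X.Nonempty) (hy : ∀ p ∈ X, 1 ≤ y p) (hw : ∀ p ∈ X, 0 ≤ w p)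
    (hgap : ∀ p ∈ X, ∀ q ∈ X, p ≠ q → y p ≤ y q → y p * w p ≤ y q) :
    ∃ q ∈ X, (∀ p ∈ X, y p ≤ y q) ∧ ∏ p ∈ X.erase q, w p ≤ y q := by
  induction X using Finset.strongInduction with
  | H X ih =>
    obtain ⟨q, hq, hmax⟩ := X.exists_max_image y hX
    refine ⟨q, hq, hmax, ?_⟩
    rcases (X.erase q).eq_empty_or_nonempty with h0 | h0
    · rw [h0, Finset.prod_empty]; exact hy q hq
    have hsub {p : ι} (hp : p ∈ X.erase q) : p ∈ X := Finset.mem_of_mem_erase hp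
    obtain ⟨p, hp, -, hle⟩ := ih (X.erase q) (Finset.erase_ssubset hq) h0
      (fun p hp => hy p (hsub hp)) (fun p hp => hw p (hsub hp))
      (fun p hp q hq => hgap p (hsub hp) q (hsub hq))
    rw [← Finset.mul_prod_erase _ _ hp]
    calc w p * ∏ x ∈ (X.erase q).erase p, w x ≤ w p * y p :=
          mul_le_mul_of_nonneg_left hle (hw p (hsub hp))
      _ = y p * w p := mul_comm _ _
      _ ≤ y q := hgap p (hsub hp) q hq (Finset.ne_of_mem_erase hp) (hmax p (hsub hp))

/-- A measure, at least one, of how well `p.1 / p.2` approximates `α i`. -/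
noncomputable def approxWeight (α : Fin 4 → ℂ) (p : ℤ × ℤ) (i : Fin 4) : ℝ :=
  max 1 (2 / 5 * (1 / 2 + (p.2 * ‖(p.1 : ℂ) - α i * p.2‖)⁻¹))

theorem one_le_approxWeight (α : Fin 4 → ℂ) (p : ℤ × ℤ) (i : Fin 4) : 1 ≤ approxWeight α p i :=
  le_max_left _ _

theorem one_le_prod_approxWeight (α : Fin 4 → ℂ) (p : ℤ × ℤ) : 1 ≤ ∏ i, approxWeight α p i :=
  Finset.one_le_prod fun i _ => one_le_approxWeight α p i

theorem half_add_inv_le_approxWeight (α : Fin 4 → ℂ) (p : ℤ × ℤ) (i : Fin 4) :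
    1 / 2 + (p.2 * ‖(p.1 : ℂ) - α i * p.2‖)⁻¹ ≤ 5 / 2 * approxWeight α p i := by
  have := le_max_right 1 (2 / 5 * (1 / 2 + (p.2 * ‖(p.1 : ℂ) - α i * p.2‖)⁻¹))
  rw [← approxWeight] at this
  linarith

theorem approxWeight_eq_one {α : Fin 4 → ℂ} {p : ℤ × ℤ} {i : Fin 4}
    (h : 1 ≤ 2 * (p.2 * ‖(p.1 : ℂ) - α i * p.2‖)) : approxWeight α p i = 1 := by
  refine max_eq_left ?_
  have : (p.2 * ‖(p.1 : ℂ) - α i * p.2‖)⁻¹ ≤ (1 / 2)⁻¹ :=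
    inv_anti₀ (by norm_num) (by linarith)
  norm_num at this ⊢
  linarith

theorem mul_approxWeight_le {α : Fin 4 → ℂ} {p q : ℤ × ℤ} {i : Fin 4} (hp : 0 < p.2)
    (hpq : p.2 ≤ q.2) (hne : p.1 * q.2 ≠ q.1 * p.2)
    (h0 : 0 < ‖(p.1 : ℂ) - α i * p.2‖)
    (hq : 2 * (q.2 * ‖(q.1 : ℂ) - α i * q.2‖) ≤ 1) : p.2 * approxWeight α p i ≤ q.2 := by
  rcases le_total 1 (2 * (p.2 * ‖(p.1 : ℂ) - α i * p.2‖)) with hp2 | hp2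
  · rw [approxWeight_eq_one hp2, mul_one]; exact_mod_cast hpq
  have hp' : (0 : ℝ) < p.2 := by exact_mod_cast hp
  have hpq' : (p.2 : ℝ) ≤ q.2 := by exact_mod_cast hpq
  have hdet : 1 ≤ ‖(p.1 : ℂ) - α i * p.2‖ * q.2 + ‖(q.1 : ℂ) - α i * q.2‖ * p.2 := by
    have h3 : (1 : ℝ) ≤ ‖((p.1 * q.2 - q.1 * p.2 : ℤ) : ℂ)‖ := by
      rw [Complex.norm_intCast]
      exact_mod_cast Int.one_le_abs (sub_ne_zero.mpr hne)
    have h4 : ((p.1 * q.2 - q.1 * p.2 : ℤ) : ℂ) =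
        ((p.1 : ℂ) - α i * p.2) * q.2 - ((q.1 : ℂ) - α i * q.2) * p.2 := by push_cast; ring
    have h5 := norm_sub_le (((p.1 : ℂ) - α i * p.2) * q.2) (((q.1 : ℂ) - α i * q.2) * p.2)
    rw [h4] at h3
    rw [norm_mul, norm_mul, Complex.norm_intCast, Complex.norm_intCast, abs_of_pos hp',
      abs_of_pos (hp'.trans_le hpq')] at h5
    linarith
  have hq' : 2 * (‖(q.1 : ℂ) - α i * q.2‖ * p.2) ≤ 1 := by
    have := mul_le_mul_of_nonneg_left hpq' (norm_nonneg ((q.1 : ℂ) - α i * q.2))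
    linarith
  set l := ‖(p.1 : ℂ) - α i * p.2‖ with hl
  have h1 : 1 ≤ 2 * (l * q.2) := by linarith
  rw [approxWeight, ← hl, mul_max_of_nonneg _ _ hp'.le, mul_one]
  refine max_le hpq' ?_
  have h2 : p.2 * (2 / 5 * (1 / 2 + (p.2 * l)⁻¹)) = p.2 / 5 + 2 / 5 / l := by
    field_simp
  rw [h2, div_add_div _ _ (by norm_num) h0.ne', div_le_iff₀ (by positivity)]
  linarith

namespace QuarticRoots

variable {b c d e : ℤ} {α : Fin 4 → ℂ}

theorem prod_norm_eq_one (h : QuarticRoots b c d e α) {x y : ℤ}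
    (hxy : |quarticEval 1 b c d e x y| = 1) : ∏ i, ‖(x : ℂ) - α i * y‖ = 1 := by
  rw [← norm_prod, ← h.quarticEval_eq, Complex.norm_intCast]
  exact_mod_cast hxy

theorem norm_sub_pos (h : QuarticRoots b c d e α) {x y : ℤ}
    (hxy : |quarticEval 1 b c d e x y| = 1) (i : Fin 4) : 0 < ‖(x : ℂ) - α i * y‖ := by
  refine (norm_nonneg _).lt_of_ne' fun h0 => ?_
  have := h.prod_norm_eq_one hxy
  rw [Finset.prod_eq_zero (Finset.mem_univ i) h0] at this
  norm_num at this

theorem abs_quarticDisc_le_approxWeight (h : QuarticRoots b c d e α) {p : ℤ × ℤ} (hp : 0 < p.2)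
    (hone : |quarticEval 1 b c d e p.1 p.2| = 1) :
    |(quarticDisc 1 b c d e : ℝ)| ≤ 5 ^ 12 * (∏ i, approxWeight α p i) ^ 6 := by
  have hp' : (0 : ℝ) < p.2 := by exact_mod_cast hp
  have h1 := h.abs_quarticDisc_le (ρ := fun i => ‖(p.1 : ℂ) - α i * p.2‖ * approxWeight α p i)
    (B := 5) (fun i => mul_nonneg (norm_nonneg _) (zero_le_one.trans (one_le_approxWeight α p i)))
    (by norm_num) fun i j => ?_
  · rwa [Finset.prod_mul_distrib, h.prod_norm_eq_one hone, one_mul] at h1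
  have hi := h.norm_sub_pos hone i
  have hj := h.norm_sub_pos hone j
  have hwi := half_add_inv_le_approxWeight α p i
  have hwj := half_add_inv_le_approxWeight α p j
  have h1i := one_le_approxWeight α p i
  have h1j := one_le_approxWeight α p j
  have h2 : ‖α i - α j‖ * p.2 ≤ ‖(p.1 : ℂ) - α j * p.2‖ + ‖(p.1 : ℂ) - α i * p.2‖ := by
    have h3 := norm_sub_le ((p.1 : ℂ) - α j * p.2) ((p.1 : ℂ) - α i * p.2)
    have h4 : ((p.1 : ℂ) - α j * p.2) - ((p.1 : ℂ) - α i * p.2) = (α i - α j) * p.2 := by ring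
    rwa [h4, norm_mul, Complex.norm_intCast, abs_of_pos hp'] at h3
  set u := ‖(p.1 : ℂ) - α i * p.2‖
  set v := ‖(p.1 : ℂ) - α j * p.2‖
  calc ‖α i - α j‖ ≤ (v + u) / p.2 := by rwa [le_div_iff₀ hp']
    _ = u * v * ((p.2 * u)⁻¹ + (p.2 * v)⁻¹) := by field_simp
    _ ≤ u * v * (5 * (approxWeight α p i * approxWeight α p j)) := by
      refine mul_le_mul_of_nonneg_left ?_ (by positivity)
      nlinarith
    _ = _ := by ring

/-- `α` has almost minimal height among the root systems of the equivalent monic forms. -/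
def IsReduced (b c d e : ℤ) (α : Fin 4 → ℂ) : Prop :=
  ∀ x y x' y' : ℤ, |quarticEval 1 b c d e x y| = 1 → x * y' - x' * y = 1 →
    rootHeight α ≤ 2 * ∏ i, max 1 ‖((x' : ℂ) - α i * y') / (x - α i * y)‖

theorem exists_abs_le_half {x y : ℤ} (hxy : IsCoprime x y) (hy : 0 < y) :
    ∃ x' y' : ℤ, x * y' - x' * y = 1 ∧ 2 * |y'| ≤ y := by
  obtain ⟨u, v, huv⟩ := hxy
  have h1 := Int.emod_add_mul_ediv u y
  have h2 := Int.emod_nonneg u hy.ne'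
  have h3 := Int.emod_lt_of_pos u hy
  rcases le_total (2 * (u % y)) y with h4 | h4
  · refine ⟨-v - x * (u / y), u % y, ?_, by rwa [abs_of_nonneg h2]⟩
    linear_combination huv + x * h1
  · refine ⟨-v - x * (u / y) - x, u % y - y, ?_, ?_⟩
    · linear_combination huv + x * h1
    · rw [abs_of_neg (by omega)]; omega

theorem rootHeight_le_approxWeight (h : QuarticRoots b c d e α) (hmin : IsReduced b c d e α)
    {p : ℤ × ℤ} (hp : 0 < p.2) (hone : |quarticEval 1 b c d e p.1 p.2| = 1) :
    rootHeight α ≤ 625 / 8 * ∏ i, approxWeight α p i := by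
  have hp' : (0 : ℝ) < p.2 := by exact_mod_cast hp
  obtain ⟨x', y', hdet, hy'⟩ :=
    exists_abs_le_half (isCoprime_of_abs_quarticEval_eq_one hone) hp
  have hy'' : 2 * |(y' : ℝ)| ≤ p.2 := by exact_mod_cast hy'
  have hle (i : Fin 4) : max 1 ‖((x' : ℂ) - α i * y') / (p.1 - α i * p.2)‖ ≤
      5 / 2 * approxWeight α p i := by
    refine max_le (by linarith [one_le_approxWeight α p i]) ?_
    refine le_trans ?_ (half_add_inv_le_approxWeight α p i)
    have h0 : (p.1 : ℂ) - α i * p.2 ≠ 0 := norm_pos_iff.mp (h.norm_sub_pos hone i)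
    have hp0 : (p.2 : ℂ) ≠ 0 := by exact_mod_cast hp.ne'
    have hdet' : (p.1 : ℂ) * y' - x' * p.2 = 1 := by exact_mod_cast hdet
    have h1 : ((x' : ℂ) - α i * y') / (p.1 - α i * p.2) =
        y' / p.2 - (p.2 * ((p.1 : ℂ) - α i * p.2))⁻¹ := by
      field_simp
      linear_combination -hdet'
    rw [h1]
    refine (norm_sub_le _ _).trans ?_
    rw [norm_div, norm_inv, norm_mul, Complex.norm_intCast, Complex.norm_intCast, abs_of_pos hp']
    refine add_le_add_left ?_ _
    rw [div_le_iff₀ hp']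
    linarith
  calc rootHeight α ≤ 2 * ∏ i, max 1 ‖((x' : ℂ) - α i * y') / (p.1 - α i * p.2)‖ :=
        hmin _ _ _ _ hone hdet
    _ ≤ 2 * ∏ i, (5 / 2 * approxWeight α p i) := by
        gcongr with i
        exact hle i
    _ = _ := by rw [Fin.prod_univ_four, Fin.prod_univ_four]; ring

theorem exists_prod_approxWeight_le (h : QuarticRoots b c d e α) (T : Finset (ℤ × ℤ)) {B : ℝ}
    (hB : 1 ≤ B) (hpos : ∀ p ∈ T, 0 < p.2) (hone : ∀ p ∈ T, |quarticEval 1 b c d e p.1 p.2| = 1)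
    (hsmall : ∀ p ∈ T, (p.2 : ℝ) ≤ B) (i : Fin 4) :
    ∃ q : ℤ × ℤ, ∏ p ∈ T.erase q, approxWeight α p i ≤ B := by
  set X := T.filter fun p => 2 * (p.2 * ‖(p.1 : ℂ) - α i * p.2‖) ≤ 1 with hXdef
  have hXT {p : ℤ × ℤ} (hp : p ∈ X) : p ∈ T := (Finset.mem_filter.mp hp).1
  have hprod (q : ℤ × ℤ) :
      ∏ p ∈ T.erase q, approxWeight α p i = ∏ p ∈ X.erase q, approxWeight α p i := by
    symm
    refine Finset.prod_subset (Finset.erase_subset_erase q (Finset.filter_subset _ _)) ?_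
    intro p hp hpX
    obtain ⟨hpq, hpT⟩ := Finset.mem_erase.mp hp
    refine approxWeight_eq_one (le_of_not_ge fun hle => hpX ?_)
    exact Finset.mem_erase.mpr ⟨hpq, Finset.mem_filter.mpr ⟨hpT, hle⟩⟩
  rcases X.eq_empty_or_nonempty with h0 | h0
  · refine ⟨0, ?_⟩
    rw [hprod, h0]
    simpa using hB
  have hgap : ∀ p ∈ X, ∀ q ∈ X, p ≠ q → (p.2 : ℝ) ≤ q.2 → p.2 * approxWeight α p i ≤ q.2 := ?_
  · obtain ⟨q, hq, -, hle⟩ := exists_prod_erase_le (fun p : ℤ × ℤ => (p.2 : ℝ))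
      (fun p => approxWeight α p i) X h0
      (fun p hp => by exact_mod_cast hpos p (hXT hp))
      (fun p hp => zero_le_one.trans (one_le_approxWeight α p i)) hgap
    exact ⟨q, (hprod q).trans_le (hle.trans (hsmall q (hXT hq)))⟩
  intro p hp q hq hpq hle
  refine mul_approxWeight_le (hpos p (hXT hp)) (by exact_mod_cast hle) (fun heq => hpq ?_)
    (h.norm_sub_pos (hone p (hXT hp)) i) (Finset.mem_filter.mp hq).2
  obtain ⟨h1, h2⟩ := eq_of_mul_eq_mul_of_isCoprime
    (isCoprime_of_abs_quarticEval_eq_one (hone p (hXT hp)))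
    (isCoprime_of_abs_quarticEval_eq_one (hone q (hXT hq))) (hpos p (hXT hp))
    (hpos q (hXT hq)) heq
  exact Prod.ext h1 h2

theorem mul_log_rootHeight_le (h : QuarticRoots b c d e α) (hmin : IsReduced b c d e α) {κ : ℝ}
    (hκ0 : 0 < κ) (hκ1 : κ < 1)
    (hD : Real.log ((7 / 2 : ℝ) ^ 12 * 4 ^ 4) <
      (1 - κ) * Real.log |(quarticDisc 1 b c d e : ℝ)|)
    {p : ℤ × ℤ} (hp : 0 < p.2) (hone : |quarticEval 1 b c d e p.1 p.2| = 1) :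
    3 * κ / 4 * Real.log (rootHeight α) ≤ Real.log (∏ i, approxWeight α p i) := by
  have hG := one_le_prod_approxWeight α p
  have h1 := h.abs_quarticDisc_le_approxWeight hp hone
  have h2 := h.rootHeight_le_approxWeight hmin hp hone
  have hM := one_le_rootHeight α
  set G := ∏ i, approxWeight α p i
  set M := rootHeight α
  set D := |(quarticDisc 1 b c d e : ℝ)|
  have hL1 : 0 < Real.log ((7 / 2 : ℝ) ^ 12 * 4 ^ 4) := Real.log_pos (by norm_num)
  have hD0 : 0 < D := by
    rcases (abs_nonneg (quarticDisc 1 b c d e : ℝ)).eq_or_lt' with h0 | h0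
    · change D = 0 at h0
      rw [h0, Real.log_zero] at hD
      linarith
    · exact h0
  have h3 : Real.log D ≤ Real.log (5 ^ 12) + 6 * Real.log G := by
    have := Real.log_le_log hD0 h1
    rwa [Real.log_mul (by positivity) (by positivity), Real.log_pow G] at this
  have h4 : Real.log M ≤ Real.log (625 / 8) + Real.log G := by
    have := Real.log_le_log (by linarith) h2
    rwa [Real.log_mul (by positivity) (by positivity)] at this
  have h5 : Real.log (5 ^ 12) ≤ Real.log ((7 / 2 : ℝ) ^ 12 * 4 ^ 4) :=
    Real.log_le_log (by positivity) (by norm_num)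
  have h6 : 9 * Real.log (625 / 8) ≤ 2 * Real.log ((7 / 2 : ℝ) ^ 12 * 4 ^ 4) := by
    have : Real.log ((625 / 8) ^ 9) ≤ Real.log (((7 / 2 : ℝ) ^ 12 * 4 ^ 4) ^ 2) :=
      Real.log_le_log (by positivity) (by norm_num)
    rw [Real.log_pow, Real.log_pow] at this
    exact_mod_cast this
  generalize Real.log ((7 / 2 : ℝ) ^ 12 * 4 ^ 4) = L₁ at *
  generalize Real.log (5 ^ 12) = L₂ at *
  generalize Real.log (625 / 8) = L₃ at *
  have h7 : 0 ≤ Real.log M := Real.log_nonneg hM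
  rcases le_total (9 * Real.log M) (2 * Real.log D) with h8 | h8
  · have := mul_le_mul_of_nonneg_left h8 hκ0.le
    linarith
  · have := mul_le_mul_of_nonneg_left h8 (by linarith : 0 ≤ 1 - κ)
    have := mul_nonneg hκ0.le h7
    linarith

theorem card_small_le (h : QuarticRoots b c d e α) (hmin : IsReduced b c d e α) {κ : ℝ}
    (hκ0 : 0 < κ) (hκ1 : κ < 1)
    (hD : Real.log ((7 / 2 : ℝ) ^ 12 * 4 ^ 4) <
      (1 - κ) * Real.log |(quarticDisc 1 b c d e : ℝ)|)
    (hM : 1 < rootHeight α) (T : Finset (ℤ × ℤ)) (hpos : ∀ p ∈ T, 0 < p.2)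
    (hone : ∀ p ∈ T, |quarticEval 1 b c d e p.1 p.2| = 1)
    (hsmall : ∀ p ∈ T, (p.2 : ℝ) ^ 2 ≤ rootHeight α ^ 3) : (T.card : ℝ) ≤ 4 + 8 / κ := by
  set M := rootHeight α
  have hsmall' (p : ℤ × ℤ) (hp : p ∈ T) : (p.2 : ℝ) ≤ √(M ^ 3) :=
    Real.le_sqrt_of_sq_le (hsmall p hp)
  choose q hq using h.exists_prod_approxWeight_le T
    (Real.one_le_sqrt.mpr (one_le_pow₀ hM.le)) hpos hone hsmall'
  set E := Finset.univ.image q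
  have hE : E.card ≤ 4 := Finset.card_image_le
  have hw0 (p : ℤ × ℤ) (i : Fin 4) : 0 < approxWeight α p i :=
    one_pos.trans_le (one_le_approxWeight α p i)
  have hprod : ∏ p ∈ T \ E, ∏ i, approxWeight α p i ≤ M ^ 6 := by
    rw [Finset.prod_comm]
    calc _ ≤ ∏ _i : Fin 4, √(M ^ 3) := by
          refine Finset.prod_le_prod (fun i _ => Finset.prod_nonneg fun p _ => (hw0 p i).le)
            fun i _ => (Finset.prod_le_prod_of_subset_of_one_le ?_ (fun p _ => (hw0 p i).le) ?_).trans (hq i)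
          · intro p hp
            rw [Finset.mem_sdiff] at hp
            refine Finset.mem_erase.mpr ⟨fun heq => hp.2 ?_, hp.1⟩
            exact Finset.mem_image.mpr ⟨i, Finset.mem_univ i, heq.symm⟩
          · exact fun p _ _ => one_le_approxWeight α p i
      _ = (√(M ^ 3) ^ 2) ^ 2 := by rw [Finset.prod_const, ← pow_mul]; rfl
      _ = M ^ 6 := by rw [Real.sq_sqrt (by positivity), ← pow_mul]
  have hlog : ((T \ E).card : ℝ) * (3 * κ / 4 * Real.log M) ≤ 6 * Real.log M := by
    have h1 := Real.log_le_log (Finset.prod_pos fun p _ => Finset.prod_pos fun i _ => hw0 p i) hprod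
    rw [Real.log_prod (fun p _ => (Finset.prod_pos fun i _ => hw0 p i).ne'), Real.log_pow] at h1
    refine le_trans ?_ (h1.trans_eq (by norm_num))
    rw [← nsmul_eq_mul]
    refine Finset.card_nsmul_le_sum _ _ _ fun p hp => ?_
    rw [Finset.mem_sdiff] at hp
    exact h.mul_log_rootHeight_le hmin hκ0 hκ1 hD (hpos p hp.1) (hone p hp.1)
  have hL : 0 < Real.log M := Real.log_pos hM
  have hcard : ((T \ E).card : ℝ) ≤ 8 / κ := by
    rw [le_div_iff₀ hκ0]
    refine le_of_mul_le_mul_right ?_ hL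
    linarith
  have h1 : T.card ≤ (T \ E).card + E.card := by
    have := Finset.le_card_sdiff E T
    omega
  have h2 : (T.card : ℝ) ≤ (T \ E).card + 4 := by exact_mod_cast h1.trans (by omega)
  linarith

end QuarticRoots

theorem quarticDisc_eq_of_invariants (a b c d e : ℤ) :
    27 * quarticDisc a b c d e = 4 * (12 * a * e - 3 * b * d + c ^ 2) ^ 3 -
      (72 * a * c * e + 9 * b * c * d - 27 * a * d ^ 2 - 27 * e * b ^ 2 - 2 * c ^ 3) ^ 2 := by
  rw [quarticDisc]; ring

theorem quarticDisc_neg (a b c d e : ℤ) :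
    quarticDisc (-a) (-b) (-c) (-d) (-e) = quarticDisc a b c d e := by
  rw [quarticDisc, quarticDisc]; ring

/-- A linear substitution transforms a binary quartic form into another one. -/
theorem exists_quarticEval_subst (a b c d e p q r s : ℤ) :
    ∃ a' b' c' d' e' : ℤ, a' = quarticEval a b c d e p r ∧
      (∀ x y, quarticEval a' b' c' d' e' x y =
        quarticEval a b c d e (p * x + q * y) (r * x + s * y)) ∧
      quarticDisc a' b' c' d' e' = (p * s - q * r) ^ 12 * quarticDisc a b c d e := by
  obtain ⟨a', ha⟩ : ∃ a', a' = quarticEval a b c d e p r := ⟨_, rfl⟩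
  obtain ⟨b', hb⟩ : ∃ b', b' = 4 * a * p ^ 3 * q + b * (p ^ 3 * s + 3 * p ^ 2 * q * r) +
    c * (2 * p ^ 2 * r * s + 2 * p * q * r ^ 2) + d * (3 * p * r ^ 2 * s + q * r ^ 3) +
    4 * e * r ^ 3 * s := ⟨_, rfl⟩
  obtain ⟨c', hc⟩ : ∃ c', c' = 6 * a * p ^ 2 * q ^ 2 + b * (3 * p ^ 2 * q * s + 3 * p * q ^ 2 * r) +
    c * (p ^ 2 * s ^ 2 + 4 * p * q * r * s + q ^ 2 * r ^ 2) +
    d * (3 * p * r * s ^ 2 + 3 * q * r ^ 2 * s) + 6 * e * r ^ 2 * s ^ 2 := ⟨_, rfl⟩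
  obtain ⟨d', hd⟩ : ∃ d', d' = 4 * a * p * q ^ 3 + b * (3 * p * q ^ 2 * s + q ^ 3 * r) +
    c * (2 * p * q * s ^ 2 + 2 * q ^ 2 * r * s) + d * (p * s ^ 3 + 3 * q * r * s ^ 2) +
    4 * e * r * s ^ 3 := ⟨_, rfl⟩
  obtain ⟨e', he⟩ : ∃ e', e' = quarticEval a b c d e q s := ⟨_, rfl⟩
  refine ⟨a', b', c', d', e', ha, fun x y => ?_, ?_⟩
  · simp only [ha, hb, hc, hd, he, quarticEval]; ring
  · have hI : 12 * a' * e' - 3 * b' * d' + c' ^ 2 =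
        (p * s - q * r) ^ 4 * (12 * a * e - 3 * b * d + c ^ 2) := by
      simp only [ha, hb, hc, hd, he, quarticEval]; ring
    have hJ : 72 * a' * c' * e' + 9 * b' * c' * d' - 27 * a' * d' ^ 2 - 27 * e' * b' ^ 2 -
        2 * c' ^ 3 = (p * s - q * r) ^ 6 *
          (72 * a * c * e + 9 * b * c * d - 27 * a * d ^ 2 - 27 * e * b ^ 2 - 2 * c ^ 3) := by
      simp only [ha, hb, hc, hd, he, quarticEval]; ring
    refine mul_left_cancel₀ (by norm_num : (27 : ℤ) ≠ 0) ?_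
    rw [quarticDisc_eq_of_invariants, hI, hJ]
    linear_combination -(p * s - q * r) ^ 12 * quarticDisc_eq_of_invariants a b c d e

theorem exists_monic_subst {a b c d e x y x' y' : ℤ} (hone : |quarticEval a b c d e x y| = 1)
    (hdet : x * y' - x' * y = 1) :
    ∃ b' c' d' e' : ℤ,
      (∀ u v, quarticEval 1 b' c' d' e' u v = quarticEval a b c d e x y *
        quarticEval a b c d e (x * u + x' * v) (y * u + y' * v)) ∧
      quarticDisc 1 b' c' d' e' = quarticDisc a b c d e := by
  obtain ⟨a', b', c', d', e', ha, hev, hdisc⟩ := exists_quarticEval_subst a b c d e x x' y y'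
  rw [hdet, one_pow, one_mul] at hdisc
  rw [← ha] at hone ⊢
  rcases (abs_eq zero_le_one).mp hone with h | h
  · subst h
    exact ⟨b', c', d', e', fun u v => by rw [one_mul, hev], hdisc⟩
  · refine ⟨-b', -c', -d', -e', fun u v => ?_, ?_⟩
    · rw [← hev, h, quarticEval, quarticEval]; ring
    · rw [← hdisc, h, ← quarticDisc_neg, neg_neg, neg_neg, neg_neg, neg_neg]

namespace QuarticRoots

theorem of_forall {b c d e : ℤ} {α : Fin 4 → ℂ}
    (h : ∀ u : ℤ, (quarticEval 1 b c d e u 1 : ℂ) = ∏ i, ((u : ℂ) - α i)) :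
    QuarticRoots b c d e α := by
  have h0 := h 0
  have h1 := h 1
  have h2 := h (-1)
  have h3 := h 2
  simp only [Fin.prod_univ_four, quarticEval] at h0 h1 h2 h3
  push_cast at h0 h1 h2 h3
  constructor
  · linear_combination 1 / 6 * h3 + 1 / 2 * h0 - 1 / 2 * h1 - 1 / 6 * h2
  · linear_combination (-1 / 2) * h1 - 1 / 2 * h2 + h0
  · linear_combination (-1 / 6) * h3 - 1 / 2 * h0 + h1 - 1 / 3 * h2
  · linear_combination -h0

theorem exists_roots (b c d e : ℤ) : ∃ α, QuarticRoots b c d e α := by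
  have hmonic := (monic_poly (b := b) (c := c) (d := d) (e := e)).map (Int.castRingHom ℂ)
  set P := (poly b c d e).map (Int.castRingHom ℂ) with hP
  have hsplit := IsAlgClosed.splits P
  have hcard : P.roots.card = 4 := by
    rw [← hsplit.natDegree_eq_card_roots, hP, monic_poly.natDegree_map, natDegree_poly]
  have hprod : P = (P.roots.map (X - C ·)).prod := by
    have := hsplit.eq_prod_roots
    rwa [hmonic.leadingCoeff, map_one, one_mul] at this
  obtain ⟨l, hl⟩ := Quot.exists_rep P.roots
  have hl' : P.roots = (l : Multiset ℂ) := hl.symm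
  rw [hl', Multiset.coe_card] at hcard
  obtain ⟨z₀, z₁, z₂, z₃, rfl⟩ : ∃ z₀ z₁ z₂ z₃, l = [z₀, z₁, z₂, z₃] := by
    match l, hcard with
    | [z₀, z₁, z₂, z₃], _ => exact ⟨z₀, z₁, z₂, z₃, rfl⟩
  rw [hl'] at hprod
  refine ⟨![z₀, z₁, z₂, z₃], of_forall fun u => ?_⟩
  have := congrArg (eval (u : ℂ)) hprod
  simp only [hP, poly, Polynomial.map_add, Polynomial.map_mul, Polynomial.map_pow, map_X,
    Polynomial.map_C, eval_add, eval_mul, eval_pow, eval_X, eval_C, Int.coe_castRingHom,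
    Multiset.map_coe, Multiset.prod_coe, List.map_cons, List.map_nil, List.prod_cons,
    List.prod_nil, eval_sub, eval_one] at this
  simp [Fin.prod_univ_four, quarticEval]
  linear_combination this

/-- The roots of a monic form equivalent to a monic form. -/
theorem exists_subst {b c d e : ℤ} {α : Fin 4 → ℂ} (h : QuarticRoots b c d e α)
    {x y x' y' : ℤ} (hone : |quarticEval 1 b c d e x y| = 1) (hdet : x * y' - x' * y = 1) :
    ∃ (b' c' d' e' : ℤ) (β : Fin 4 → ℂ), QuarticRoots b' c' d' e' β ∧
      rootHeight β = ∏ i, max 1 ‖((x' : ℂ) - α i * y') / (x - α i * y)‖ ∧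
      (∀ u v, |quarticEval 1 b' c' d' e' u v| =
        |quarticEval 1 b c d e (x * u + x' * v) (y * u + y' * v)|) ∧
      quarticDisc 1 b' c' d' e' = quarticDisc 1 b c d e := by
  obtain ⟨b', c', d', e', hev, hdisc⟩ := exists_monic_subst hone hdet
  refine ⟨b', c', d', e', fun i => -(((x' : ℂ) - α i * y') / (x - α i * y)), ?_, ?_, ?_, hdisc⟩
  · refine of_forall fun u => ?_
    have h1 : (quarticEval 1 b c d e x y : ℂ) * quarticEval 1 b c d e x y = 1 := by
      have : quarticEval 1 b c d e x y * quarticEval 1 b c d e x y = 1 := by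
        rw [← abs_mul_abs_self, hone]; norm_num
      exact_mod_cast this
    rw [hev, Int.cast_mul, h.quarticEval_eq (x * u + x' * 1)]
    have h2 : ∏ i, (((x * u + x' * 1 : ℤ) : ℂ) - α i * (y * u + y' * 1 : ℤ)) =
        (∏ i, ((x : ℂ) - α i * y)) *
          ∏ i, ((u : ℂ) - -(((x' : ℂ) - α i * y') / (x - α i * y))) := by
      rw [← Finset.prod_mul_distrib]
      refine Finset.prod_congr rfl fun i _ => ?_
      have h0 : (x : ℂ) - α i * y ≠ 0 := norm_pos_iff.mp (h.norm_sub_pos hone i)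
      push_cast
      field_simp
      ring
    rw [h2, ← h.quarticEval_eq, ← mul_assoc, h1, one_mul]
  · simp only [rootHeight, norm_neg]
  · intro u v
    rw [hev, abs_mul, hone, one_mul]

end QuarticRoots

/-- The monic form with coefficients `1, b', c', d', e'` is equivalent, up to sign, to the form with
coefficients `a, b, c, d, e`. -/
def IsMonicModel (a b c d e b' c' d' e' : ℤ) : Prop :=
  quarticDisc 1 b' c' d' e' = quarticDisc a b c d e ∧
    ∃ p q r s : ℤ, p * s - q * r = 1 ∧ ∀ u v, |quarticEval 1 b' c' d' e' u v| =
      |quarticEval a b c d e (p * u + q * v) (r * u + s * v)|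

/-- A form representing `±1` has a reduced monic model. -/
theorem exists_isReduced_model {a b c d e x y : ℤ} (hone : |quarticEval a b c d e x y| = 1) :
    ∃ (b' c' d' e' : ℤ) (α : Fin 4 → ℂ), IsMonicModel a b c d e b' c' d' e' ∧
      QuarticRoots b' c' d' e' α ∧ QuarticRoots.IsReduced b' c' d' e' α := by
  let A : Set ℝ := {m | ∃ (b' c' d' e' : ℤ) (α : Fin 4 → ℂ), IsMonicModel a b c d e b' c' d' e' ∧
    QuarticRoots b' c' d' e' α ∧ rootHeight α = m}
  have hA : A.Nonempty := by
    obtain ⟨u, v, huv⟩ := isCoprime_of_abs_quarticEval_eq_one hone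
    have hdet : x * u - (-v) * y = 1 := by linear_combination huv
    obtain ⟨b', c', d', e', hev, hdisc⟩ := exists_monic_subst hone hdet
    obtain ⟨α, hα⟩ := QuarticRoots.exists_roots b' c' d' e'
    refine ⟨rootHeight α, b', c', d', e', α, ⟨hdisc, x, -v, y, u, hdet, fun u v => ?_⟩, hα, rfl⟩
    rw [hev, abs_mul, hone, one_mul]
  have hbdd : BddBelow A := ⟨1, by
    rintro m ⟨b', c', d', e', α, -, -, rfl⟩
    exact one_le_rootHeight α⟩
  have hinf : 1 ≤ sInf A := le_csInf hA (by
    rintro m ⟨b', c', d', e', α, -, -, rfl⟩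
    exact one_le_rootHeight α)
  obtain ⟨m, ⟨b', c', d', e', α, ⟨hdisc, p, q, r, s, hdet, hev⟩, hα, rfl⟩, hlt⟩ :=
    exists_lt_of_csInf_lt hA (show sInf A < 2 * sInf A by linarith)
  refine ⟨b', c', d', e', α, ⟨hdisc, p, q, r, s, hdet, hev⟩, hα, fun x y x' y' hxy hdet' => ?_⟩
  obtain ⟨b₂, c₂, d₂, e₂, β, hβ, hheight, hev₂, hdisc₂⟩ := hα.exists_subst hxy hdet'
  rw [← hheight]
  have hmem : rootHeight β ∈ A := by
    refine ⟨b₂, c₂, d₂, e₂, β, ⟨hdisc₂.trans hdisc, p * x + q * y, p * x' + q * y', r * x + s * y,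
      r * x' + s * y', ?_, fun u v => ?_⟩, hβ, rfl⟩
    · linear_combination (x * y' - x' * y) * hdet + hdet'
    · rw [hev₂, hev]; ring_nf
  linarith [csInf_le hbdd hmem]

namespace QuarticRoots

variable {b c d e : ℤ} {α : Fin 4 → ℂ}

theorem log_lt_imp_lt {L D κ : ℝ} (hL : 1 ≤ L) (hκ0 : 0 < κ) (hκ1 : κ < 1)
    (h : Real.log L < (1 - κ) * Real.log |D|) : L < |D| := by
  have h0 := Real.log_nonneg hL
  have h1 : 0 < Real.log |D| := by
    by_contra! h1
    linarith [mul_nonneg (neg_nonneg.mpr h1) (by linarith : 0 ≤ 1 - κ)]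
  have hD : 0 < |D| := by
    refine (abs_nonneg D).lt_of_ne' fun h2 => ?_
    rw [h2, Real.log_zero] at h1
    exact h1.ne rfl
  rw [← Real.log_lt_log_iff (by linarith) hD]
  linarith [mul_pos hκ0 h1]

theorem card_le (h : QuarticRoots b c d e α) (hmin : IsReduced b c d e α)
    (hrat : ∀ i (q : ℚ), α i ≠ q) {κ : ℝ} (hκ0 : 0 < κ) (hκ1 : κ < 1)
    (hD : Real.log ((7 / 2 : ℝ) ^ 12 * 4 ^ 4) <
      (1 - κ) * Real.log |(quarticDisc 1 b c d e : ℝ)|) (T : Finset (ℤ × ℤ))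
    (hone : ∀ p ∈ T, |quarticEval 1 b c d e p.1 p.2| = 1) (hneg : ∀ p ∈ T, -p ∉ T) :
    (T.card : ℝ) ≤ 34 + 8 / κ := by
  have hD' := log_lt_imp_lt (by norm_num) hκ0 hκ1 hD
  have hM := h.le_rootHeight hD'
  set M := rootHeight α
  have hev (x y : ℤ) : quarticEval 1 b c d e (-x) (-y) = quarticEval 1 b c d e x y := by
    rw [quarticEval, quarticEval]; ring
  -- the sign of each solution is normalised so that its second coordinate is nonnegative
  let σ (p : ℤ × ℤ) : ℤ × ℤ := if 0 ≤ p.2 then p else -p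
  have hσ (p : ℤ × ℤ) : 0 ≤ (σ p).2 := by
    by_cases h0 : 0 ≤ p.2
    · simp [σ, h0]
    · simp [σ, h0]; omega
  have hσone (p : ℤ × ℤ) (hp : p ∈ T) : |quarticEval 1 b c d e (σ p).1 (σ p).2| = 1 := by
    by_cases h0 : 0 ≤ p.2
    · simpa [σ, h0] using hone p hp
    · simpa [σ, h0, hev] using hone p hp
  have hinj : Set.InjOn σ T := by
    intro p hp q hq hpq
    by_cases h0 : 0 ≤ p.2 <;> by_cases h1 : 0 ≤ q.2 <;> simp only [σ, h0, h1, if_true, if_false] at hpq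
    · exact hpq
    · exact absurd hp (hpq ▸ hneg q hq)
    · exact absurd hq (hpq ▸ hneg p hp)
    · exact neg_injective hpq
  set V := T.image σ
  have hV : V.card = T.card := Finset.card_image_of_injOn hinj
  have hVone (p) (hp : p ∈ V) : 0 ≤ p.2 ∧ |quarticEval 1 b c d e p.1 p.2| = 1 := by
    obtain ⟨q, hq, rfl⟩ := Finset.mem_image.mp hp
    exact ⟨hσ q, hσone q hq⟩
  set V₁ := V.filter fun p => 0 < p.2 ∧ (p.2 : ℝ) ^ 2 ≤ M ^ 3
  set V₂ := V.filter fun p => 0 < p.2 ∧ M ^ 3 ≤ (p.2 : ℝ) ^ 2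
  have hsub : V ⊆ {(1, 0), (-1, 0)} ∪ (V₁ ∪ V₂) := by
    intro p hp
    obtain ⟨h1, h2⟩ := hVone p hp
    rcases h1.eq_or_lt with h0 | h0
    · refine Finset.mem_union_left _ ?_
      obtain ⟨x, y⟩ := p
      obtain rfl : 0 = y := h0
      have : |x| = 1 := by
        have h3 : |x| ^ 4 = 1 := by simpa [quarticEval, abs_pow] using h2
        exact (pow_eq_one_iff_of_nonneg (abs_nonneg x) (by norm_num)).mp h3
      rcases (abs_eq zero_le_one).mp this with rfl | rfl <;> simp
    · refine Finset.mem_union_right _ (Finset.mem_union.mpr ?_)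
      rcases le_total ((p.2 : ℝ) ^ 2) (M ^ 3) with h3 | h3
      · exact Or.inl (Finset.mem_filter.mpr ⟨hp, h0, h3⟩)
      · exact Or.inr (Finset.mem_filter.mpr ⟨hp, h0, h3⟩)
  have h1 : (V₁.card : ℝ) ≤ 4 + 8 / κ := h.card_small_le hmin hκ0 hκ1 hD (by linarith) V₁
    (fun p hp => (Finset.mem_filter.mp hp).2.1)
    (fun p hp => (hVone p (Finset.mem_filter.mp hp).1).2)
    (fun p hp => (Finset.mem_filter.mp hp).2.2)
  have h2 : V₂.card ≤ 28 := h.card_large_le hrat hD' V₂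
    (fun p hp => (Finset.mem_filter.mp hp).2.1)
    (fun p hp => (hVone p (Finset.mem_filter.mp hp).1).2)
    (fun p hp => (Finset.mem_filter.mp hp).2.2)
  have h3 : T.card ≤ 2 + (V₁.card + 28) := by
    rw [← hV]
    exact (Finset.card_le_card hsub).trans ((Finset.card_union_le _ _).trans
      (Nat.add_le_add Finset.card_le_two ((Finset.card_union_le _ _).trans (by omega))))
  have h4 : (T.card : ℝ) ≤ 2 + (V₁.card + 28) := by exact_mod_cast h3
  linarith

end QuarticRoots

/-- Up to sign, a form of large discriminant without rational zeros represents `±1` at most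
`36 + 8 / κ` times. -/
theorem exists_finset_of_log_lt {a b c d e : ℤ}
    (hzero : ∀ x y, quarticEval a b c d e x y = 0 → x = 0 ∧ y = 0) {κ : ℝ} (hκ0 : 0 < κ)
    (hκ1 : κ < 1)
    (hD : Real.log ((7 / 2 : ℝ) ^ 12 * 4 ^ 4) <
      (1 - κ) * Real.log |(quarticDisc a b c d e : ℝ)|) :
    ∃ S : Finset (ℤ × ℤ), S.card ≤ ⌊36 + 8 / κ⌋₊ ∧
      ∀ x y, |quarticEval a b c d e x y| = 1 → (x, y) ∈ S ∨ (-x, -y) ∈ S := by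
  let A : Set (ℤ × ℤ) := {p | |quarticEval a b c d e p.1 p.2| = 1 ∧ (0 < p.2 ∨ p.2 = 0 ∧ 0 < p.1)}
  have hA (T : Finset (ℤ × ℤ)) (hT : (T : Set (ℤ × ℤ)) ⊆ A) : T.card ≤ ⌊36 + 8 / κ⌋₊ := by
    rcases T.eq_empty_or_nonempty with rfl | ⟨p₀, hp₀⟩
    · simp
    obtain ⟨b', c', d', e', α, ⟨hdisc, p, q, r, s, hdet, hev⟩, hα, hmin⟩ :=
      exists_isReduced_model (hT hp₀).1
    rw [← hdisc] at hD
    have hrat (i : Fin 4) (t : ℚ) : α i ≠ t := by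
      intro heq
      have h0 : quarticEval 1 b' c' d' e' t.num t.den = 0 := by
        have h1 := hα.quarticEval_eq t.num t.den
        rw [Finset.prod_eq_zero (Finset.mem_univ i)] at h1
        · exact_mod_cast h1
        · rw [heq]
          have : (t : ℂ) * t.den = t.num := by exact_mod_cast t.mul_den_eq_num
          push_cast
          rw [this, sub_self]
      have h1 := hev t.num t.den
      rw [h0, abs_zero, eq_comm, abs_eq_zero] at h1
      obtain ⟨h2, h3⟩ := hzero _ _ h1
      have h4 : (t.den : ℤ) = 0 := by linear_combination p * h3 - r * h2 - t.den * hdet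
      exact t.den_nz (by exact_mod_cast h4)
    let σ (z : ℤ × ℤ) : ℤ × ℤ := (s * z.1 - q * z.2, p * z.2 - r * z.1)
    have hσ1 (z : ℤ × ℤ) : p * (σ z).1 + q * (σ z).2 = z.1 := by
      simp only [σ]; linear_combination z.1 * hdet
    have hσ2 (z : ℤ × ℤ) : r * (σ z).1 + s * (σ z).2 = z.2 := by
      simp only [σ]; linear_combination z.2 * hdet
    have hinj : Function.Injective σ := fun z w hzw =>
      Prod.ext (by rw [← hσ1, ← hσ1 w, hzw]) (by rw [← hσ2, ← hσ2 w, hzw])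
    have hσneg (z : ℤ × ℤ) : -σ z = σ (-z) := by
      ext <;> simp only [σ, Prod.fst_neg, Prod.snd_neg] <;> ring
    have hcard := hα.card_le hmin hrat hκ0 hκ1 hD (T.image σ) ?_ ?_
    · rw [Finset.card_image_of_injective _ hinj] at hcard
      exact Nat.le_floor (by linarith)
    · intro z hz
      obtain ⟨w, hw, rfl⟩ := Finset.mem_image.mp hz
      rw [hev, hσ1, hσ2]
      exact (hT hw).1
    · intro z hz hz'
      obtain ⟨w, hw, rfl⟩ := Finset.mem_image.mp hz
      rw [hσneg, hinj.mem_finset_image] at hz'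
      have h1 := (hT hw).2
      have h2 := (hT hz').2
      rw [Prod.fst_neg, Prod.snd_neg] at h2
      omega
  have hfin : A.Finite := by
    by_contra hinf
    obtain ⟨T, hT, hcard⟩ := Set.Infinite.exists_subset_card_eq hinf (⌊36 + 8 / κ⌋₊ + 1)
    have := hA T hT
    omega
  refine ⟨hfin.toFinset, hA _ (by rw [hfin.coe_toFinset]), fun x y hxy => ?_⟩
  have hev : |quarticEval a b c d e (-x) (-y)| = 1 := by
    rw [← hxy, quarticEval, quarticEval]; congr 1; ring
  rw [hfin.mem_toFinset, hfin.mem_toFinset]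
  have h0 : x ≠ 0 ∨ y ≠ 0 := by
    by_contra! h0
    rw [h0.1, h0.2] at hxy
    norm_num [quarticEval] at hxy
  by_cases h1 : 0 < y ∨ y = 0 ∧ 0 < x
  · exact Or.inl ⟨hxy, h1⟩
  · exact Or.inr ⟨hev, by simp only; omega⟩

theorem dedekindPsi_mul {m n : ℕ} (h : m.Coprime n) :
    dedekindPsi (m * n) = dedekindPsi m * dedekindPsi n := by
  rw [dedekindPsi, dedekindPsi, dedekindPsi, h.primeFactors_mul,
    Finset.prod_union h.disjoint_primeFactors]
  push_cast
  ring

theorem dedekindPsi_prime_pow {p : ℕ} (hp : p.Prime) (k : ℕ) :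
    dedekindPsi (p ^ (k + 1)) = p ^ (k + 1) + p ^ k := by
  have : (p : ℚ) ≠ 0 := by exact_mod_cast hp.ne_zero
  rw [dedekindPsi, Nat.primeFactors_prime_pow (by omega) hp, Finset.prod_singleton]
  push_cast
  field_simp
  ring

/-- The form has no nontrivial rational zeros. -/
def IsAnisotropic (a b c d e : ℤ) : Prop :=
  ∀ x y, quarticEval a b c d e x y = 0 → x = 0 ∧ y = 0

/-- Up to sign, the form represents `±1` at most `N` times. -/
def RepresentsUnitsAtMost (a b c d e : ℤ) (N : ℚ) : Prop :=
  ∃ S : Finset (ℤ × ℤ), (S.card : ℚ) ≤ N ∧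
    ∀ x y, |quarticEval a b c d e x y| = 1 → (x, y) ∈ S ∨ (-x, -y) ∈ S

theorem isAnisotropic_of_irreducible {a b c d e : ℤ} (ha : a ≠ 0)
    (hirr : Irreducible (quarticPoly a b c d e)) : IsAnisotropic a b c d e := by
  intro x y hxy
  have hy : y = 0 := by
    by_contra hy
    have hy' : (y : ℚ) ≠ 0 := by exact_mod_cast hy
    have ha' : (a : ℚ) ≠ 0 := by exact_mod_cast ha
    have hroot : (quarticPoly a b c d e).IsRoot ((x : ℚ) / y) := by
      have h1 : ((quarticEval a b c d e x y : ℤ) : ℚ) = 0 := by rw [hxy, Int.cast_zero]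
      rw [quarticEval] at h1
      push_cast at h1
      simp only [IsRoot.def, quarticPoly, eval_add, eval_mul, eval_pow, eval_C, eval_X]
      field_simp
      linear_combination h1
    have h4 : (quarticPoly a b c d e).degree = 4 := by
      unfold quarticPoly
      compute_degree!
    rw [degree_eq_one_of_irreducible_of_root hirr hroot] at h4
    norm_num at h4
  subst hy
  refine ⟨?_, rfl⟩
  simpa [quarticEval, ha] using hxy

/-- Bounding the representations of units by passing to finitely many sublattices which contain all
the solutions. -/
theorem RepresentsUnitsAtMost.of_sublattices {ι : Type*} {a b c d e m : ℤ} (hm : m ≠ 0)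
    (hani : IsAnisotropic a b c d e) {L : ℝ} {N : ℚ}
    (hN : ∀ a' b' c' d' e', IsAnisotropic a' b' c' d' e' → L < |(quarticDisc a' b' c' d' e' : ℝ)| →
      RepresentsUnitsAtMost a' b' c' d' e' N)
    (hL : L < (m : ℝ) ^ 12 * |(quarticDisc a b c d e : ℝ)|) (I : Finset ι) (p q r s : ι → ℤ)
    (hdet : ∀ i ∈ I, p i * s i - q i * r i = m)
    (hcover : ∀ x y, |quarticEval a b c d e x y| = 1 →
      ∃ i ∈ I, ∃ u v, p i * u + q i * v = x ∧ r i * u + s i * v = y) :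
    RepresentsUnitsAtMost a b c d e (I.card * N) := by
  classical
  have key (i : ι) (hi : i ∈ I) : ∃ S : Finset (ℤ × ℤ), (S.card : ℚ) ≤ N ∧
      ∀ u v, |quarticEval a b c d e (p i * u + q i * v) (r i * u + s i * v)| = 1 →
        (p i * u + q i * v, r i * u + s i * v) ∈ S ∨
          (-(p i * u + q i * v), -(r i * u + s i * v)) ∈ S := by
    obtain ⟨a', b', c', d', e', -, hev, hdisc⟩ :=
      exists_quarticEval_subst a b c d e (p i) (q i) (r i) (s i)
    rw [hdet i hi] at hdisc
    have hani' : IsAnisotropic a' b' c' d' e' := by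
      intro u v huv
      rw [hev] at huv
      obtain ⟨h1, h2⟩ := hani _ _ huv
      have hu : m * u = 0 := by linear_combination s i * h1 - q i * h2 - u * hdet i hi
      have hv : m * v = 0 := by linear_combination p i * h2 - r i * h1 - v * hdet i hi
      exact ⟨(mul_eq_zero.mp hu).resolve_left hm, (mul_eq_zero.mp hv).resolve_left hm⟩
    obtain ⟨S, hS, hmem⟩ := hN _ _ _ _ _ hani' (by
      rw [hdisc]; push_cast; rwa [abs_mul, abs_of_nonneg (by positivity)])
    refine ⟨S.image fun z => (p i * z.1 + q i * z.2, r i * z.1 + s i * z.2),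
      le_trans (by exact_mod_cast Finset.card_image_le) hS, fun u v huv => ?_⟩
    rw [← hev] at huv
    refine (hmem u v huv).imp (fun h => Finset.mem_image.mpr ⟨_, h, rfl⟩)
      fun h => Finset.mem_image.mpr ⟨_, h, ?_⟩
    ext <;> simp only <;> ring
  choose! S hS hmem using key
  refine ⟨I.biUnion S, ?_, fun x y hxy => ?_⟩
  · calc ((I.biUnion S).card : ℚ) ≤ ∑ i ∈ I, ((S i).card : ℚ) := by
          exact_mod_cast Finset.card_biUnion_le
      _ ≤ I.card • N := Finset.sum_le_card_nsmul _ _ _ hS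
      _ = I.card * N := nsmul_eq_mul _ _
  · obtain ⟨i, hi, u, v, rfl, rfl⟩ := hcover x y hxy
    exact (hmem i hi u v hxy).imp (fun h => Finset.mem_biUnion.mpr ⟨i, hi, h⟩)
      fun h => Finset.mem_biUnion.mpr ⟨i, hi, h⟩

theorem exists_lt_dvd_sub_mul {m : ℕ} (hm : 0 < m) (x : ℤ) {y : ℤ} (h : IsCoprime y (m : ℤ)) :
    ∃ t < m, (m : ℤ) ∣ x - t * y := by
  have hm' : (0 : ℤ) < m := by exact_mod_cast hm
  obtain ⟨u, v, huv⟩ := h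
  obtain ⟨t, ht⟩ := Int.eq_ofNat_of_zero_le (Int.emod_nonneg (x * u) hm'.ne')
  have h1 := Int.emod_lt_of_pos (x * u) hm'
  refine ⟨t, by omega, x * v + (x * u / m) * y, ?_⟩
  rw [← ht]
  linear_combination (-x) * huv - y * Int.emod_add_mul_ediv (x * u) m

/-- A bound for forms of large discriminant yields a bound for forms of smaller discriminant. -/
theorem RepresentsUnitsAtMost.of_lt_mul {r : ℕ} (hr : 0 < r) {L : ℝ} {N : ℚ}
    (hN : ∀ a b c d e, IsAnisotropic a b c d e → L < |(quarticDisc a b c d e : ℝ)| →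
      RepresentsUnitsAtMost a b c d e N) {a b c d e : ℤ} (hani : IsAnisotropic a b c d e)
    (hL : L < (r : ℝ) ^ 12 * |(quarticDisc a b c d e : ℝ)|) :
    RepresentsUnitsAtMost a b c d e (dedekindPsi r * N) := by
  induction r using Nat.recOnPosPrimePosCoprime generalizing a b c d e L N with
  | zero => omega
  | one =>
    have h1 : dedekindPsi 1 = 1 := by simp [dedekindPsi]
    rw [h1, one_mul]
    exact hN _ _ _ _ _ hani (by simpa using hL)
  | prime_pow p n hp hn =>
    obtain ⟨k, rfl⟩ := Nat.exists_eq_succ_of_ne_zero hn.ne'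
    have hp' : Prime (p : ℤ) := Nat.prime_iff_prime_int.mp hp
    have hcard : dedekindPsi (p ^ (k + 1)) =
        ((Finset.range (p ^ (k + 1))).disjSum (Finset.range (p ^ k))).card := by
      rw [dedekindPsi_prime_pow hp, Finset.card_disjSum, Finset.card_range, Finset.card_range]
      push_cast
      rfl
    rw [Nat.succ_eq_add_one, hcard]
    refine of_sublattices (m := (p : ℤ) ^ (k + 1)) (pow_ne_zero _ hp'.ne_zero) hani hN
      (by simpa using hL) _ (Sum.elim (fun _ => (p : ℤ) ^ (k + 1)) fun _ => 1)
      (Sum.elim (fun t => (t : ℤ)) fun _ => 0) (Sum.elim (fun _ => 0) fun t => (p : ℤ) * t)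
      (Sum.elim (fun _ => 1) fun _ => (p : ℤ) ^ (k + 1)) ?_ fun x y hxy => ?_
    · rintro (t | t) - <;> simp
    have hco := isCoprime_of_abs_quarticEval_eq_one hxy
    by_cases hpy : (p : ℤ) ∣ y
    · have hpx : IsCoprime x (p : ℤ) := hco.of_isCoprime_of_dvd_right hpy
      obtain ⟨t, ht, w, hw⟩ := exists_lt_dvd_sub_mul (m := p ^ (k + 1)) (pow_pos hp.pos _) y
        (by push_cast; exact hpx.pow_right)
      push_cast at hw
      obtain ⟨t', ht'⟩ : p ∣ t := by
        have h1 : (p : ℤ) ∣ t * x := by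
          have h2 : (t : ℤ) * x = y - p * (p ^ k * w) := by linear_combination -hw
          rw [h2]
          exact dvd_sub hpy (dvd_mul_right _ _)
        exact_mod_cast hpx.symm.dvd_of_dvd_mul_right h1
      subst ht'
      refine ⟨Sum.inr t', ?_, x, w, ?_, ?_⟩
      · rw [pow_succ'] at ht
        exact Finset.inr_mem_disjSum.mpr (Finset.mem_range.mpr (Nat.lt_of_mul_lt_mul_left ht))
      · simp
      · push_cast at hw
        simp only [Sum.elim_inr]
        linear_combination -hw
    · obtain ⟨t, ht, w, hw⟩ := exists_lt_dvd_sub_mul (m := p ^ (k + 1)) (pow_pos hp.pos _) x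
        (y := y) (by
          push_cast
          exact (((Prime.coprime_iff_not_dvd hp').mpr hpy).symm).pow_right)
      push_cast at hw
      refine ⟨Sum.inl t, Finset.inl_mem_disjSum.mpr (Finset.mem_range.mpr ht), w, y, ?_, ?_⟩
      · simp only [Sum.elim_inl]
        linear_combination -hw
      · simp
  | coprime m n hm hn hmn ihm ihn =>
    have hm0 : (0 : ℝ) < (m : ℝ) ^ 12 := by positivity
    rw [dedekindPsi_mul hmn, mul_comm (dedekindPsi m), mul_assoc]
    refine ihn (by omega) (L := L / m ^ 12) (fun a b c d e hani hL => ?_) hani ?_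
    · refine ihm (by omega) hN hani ?_
      rwa [div_lt_iff₀' hm0] at hL
    · rw [div_lt_iff₀' hm0]
      push_cast at hL
      linarith

/-- If `f` is an irreducible integral binary quartic form and `r` is a positive integer
with `r¹²·|Disc(f)| > D₁^{1/(1-κ)}`, `D₁ = (7/2)¹²·4⁴`, `0 < κ < 1`, then `|f(x,y)| = 1`
has at most `ψ(r)·⌊36 + 8/κ⌋` integer solutions, with `(x,y) ∼ (-x,-y)` identified. -/
theorem quartic_thue_bound_in_kappa_and_r (a b c d e : ℤ)
    (ha : a ≠ 0) (hirr : Irreducible (quarticPoly a b c d e))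
    (κ : ℝ) (hκ0 : 0 < κ) (hκ1 : κ < 1) (r : ℕ) (hr : 0 < r)
    (hD : ((7/2 : ℝ) ^ 12 * 4 ^ 4) ^ ((1 : ℝ)/(1 - κ)) <
        (r : ℝ) ^ 12 * |(quarticDisc a b c d e : ℝ)|) :
    ∃ S : Finset (ℤ × ℤ),
      (S.card : ℚ) ≤ dedekindPsi r * ((⌊(36 : ℝ) + 8/κ⌋ : ℤ) : ℚ) ∧
      ∀ x y : ℤ, |quarticEval a b c d e x y| = 1 → (x, y) ∈ S ∨ (-x, -y) ∈ S := by
  refine RepresentsUnitsAtMost.of_lt_mul hr (fun a b c d e hani hL => ?_)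
    (isAnisotropic_of_irreducible ha hirr) hD
  have hκ : 0 < 1 - κ := by linarith
  have hlog : Real.log ((7 / 2 : ℝ) ^ 12 * 4 ^ 4) <
      (1 - κ) * Real.log |(quarticDisc a b c d e : ℝ)| := by
    have h1 := Real.log_lt_log (by positivity) hL
    rw [Real.log_rpow (by positivity), one_div, inv_mul_eq_div, div_lt_iff₀' hκ] at h1
    exact h1
  obtain ⟨S, hS, hmem⟩ := exists_finset_of_log_lt hani hκ0 hκ1 hlog
  refine ⟨S, ?_, hmem⟩
  rw [← Int.natCast_floor_eq_floor (by positivity)]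
  exact_mod_cast hS
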